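/- For Lebesgue-almost every pair (γ,λ) with 0 < γ < λ < 1, γλ < 1/2 and γ > 1/2, the Hausdorff dimension of the self-affine set K_{γ,λ} equals 1 + log(2λ)/log(1/γ). -/

import Mathlib

open MeasureTheory Filter Set
open scoped ENNReal Topology

noncomputable section

/-- The self-affine set `K_{γ,λ}`: attractor of the IFS
`{(x,y) ↦ (γx − 1, λy − 1), (x,y) ↦ (γx + 1, λy + 1)}`, described as the set of all sums
`∑ εₙ (γⁿ, λⁿ)` with signs `εₙ ∈ {−1, 1}`. -/
def Kpm (g l : ℝ) : Set (ℝ × ℝ) :=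
  {p | ∃ ε : ℕ → ℝ, (∀ n, ε n = 1 ∨ ε n = -1) ∧
    p = (∑' n, ε n * g ^ n, ∑' n, ε n * l ^ n)}


namespace SAB

lemma pow_sub_bound {x g ρ ε : ℝ} (hρ : 0 < ρ) (hx : |x| ≤ ρ) (hg : |g| ≤ ρ)
    (hxg : |x - g| ≤ ε) (i : ℕ) : |x ^ i - g ^ i| ≤ ε * (i * ρ ^ i / ρ) := by
  have hε : 0 ≤ ε := le_trans (abs_nonneg _) hxg
  induction i with
  | zero => simp
  | succ n ih =>
    have h1 : x ^ (n + 1) - g ^ (n + 1) = (x ^ n - g ^ n) * x + g ^ n * (x - g) := by ring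
    rw [h1]
    have h2 : |(x ^ n - g ^ n) * x| ≤ ε * (n * ρ ^ n / ρ) * ρ := by
      rw [abs_mul]; gcongr
    have h3 : |g ^ n * (x - g)| ≤ ρ ^ n * ε := by
      rw [abs_mul, abs_pow]; gcongr
    calc _ ≤ _ := abs_add_le _ _
      _ ≤ ε * (n * ρ ^ n / ρ) * ρ + ρ ^ n * ε := add_le_add h2 h3
      _ = ε * (((n + 1 : ℕ) : ℝ) * ρ ^ (n + 1) / ρ) := by
        push_cast; field_simp; ring

lemma geom_sub_bound {x y g ρ ε : ℝ} (hρ : 0 < ρ) (hx : |x| ≤ ρ) (hy : |y| ≤ ρ) (hg : |g| ≤ ρ)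
    (hxg : |x - g| ≤ ε) (hyg : |y - g| ≤ ε) (i : ℕ) :
    |(∑ j ∈ Finset.range i, x ^ j * y ^ (i - 1 - j)) - i * g ^ (i - 1)|
      ≤ ε * ((i : ℝ) ^ 2 * ρ ^ i / ρ ^ 2) := by
  have hε : 0 ≤ ε := le_trans (abs_nonneg _) hxg
  rcases Nat.eq_zero_or_pos i with rfl | hi
  · simp
  obtain ⟨n, rfl⟩ : ∃ n, i = n + 1 := ⟨i - 1, by omega⟩
  simp only [Nat.add_sub_cancel]
  have h1 : (∑ j ∈ Finset.range (n + 1), x ^ j * y ^ (n - j)) - ((n + 1 : ℕ) : ℝ) * g ^ n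
      = ∑ j ∈ Finset.range (n + 1), (x ^ j * y ^ (n - j) - g ^ n) := by
    rw [Finset.sum_sub_distrib]; simp
  rw [h1]
  refine le_trans (Finset.abs_sum_le_sum_abs _ _) ?_
  have h2 : ∀ j ∈ Finset.range (n + 1), |x ^ j * y ^ (n - j) - g ^ n| ≤ ε * (n * ρ ^ n / ρ) := by
    intro j hj
    have hj : j ≤ n := by simpa [Nat.lt_succ_iff] using hj
    obtain ⟨l, rfl⟩ := Nat.exists_eq_add_of_le hj
    simp only [Nat.add_sub_cancel_left]
    have e1 : x ^ j * y ^ l - g ^ (j + l) = (x ^ j - g ^ j) * y ^ l + g ^ j * (y ^ l - g ^ l) := by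
      ring
    rw [e1]
    have h2 : |(x ^ j - g ^ j) * y ^ l| ≤ ε * (j * ρ ^ j / ρ) * ρ ^ l := by
      rw [abs_mul, abs_pow y]
      have := pow_sub_bound hρ hx hg hxg j
      gcongr
    have h3 : |g ^ j * (y ^ l - g ^ l)| ≤ ρ ^ j * (ε * (l * ρ ^ l / ρ)) := by
      rw [abs_mul, abs_pow g]
      have := pow_sub_bound hρ hy hg hyg l
      gcongr
    calc _ ≤ _ := abs_add_le _ _
      _ ≤ _ := add_le_add h2 h3
      _ = _ := by push_cast; field_simp; ring
  refine le_trans (Finset.sum_le_sum h2) ?_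
  simp only [Finset.sum_const, Finset.card_range, nsmul_eq_mul]
  have : (n : ℝ) ≤ n + 1 := by linarith
  calc ((n + 1 : ℕ) : ℝ) * (ε * (n * ρ ^ n / ρ))
      ≤ ((n + 1 : ℕ) : ℝ) * (ε * ((n + 1) * ρ ^ n / ρ)) := by gcongr
    _ = _ := by push_cast; field_simp; ring

set_option maxHeartbeats 1600000 in
/-- Transversality lemma. -/
lemma transv (e : ℕ → ℕ) (he : StrictMono e) (he0 : e 0 = 0) (g0 : ℝ) (hg0 : 0 < g0)
    (hg1 : g0 < 1) (c : ℝ) (w : ℕ → ℝ) (hw : Summable fun k => |w k|) (α β : ℝ)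
    (h : ∑' k, |c * w (k + 1) + α * g0 ^ e (k + 1) + β * (e (k + 1) * g0 ^ (e (k + 1) - 1))|
      < c * w 0 + α) :
    ∃ ε0 > 0, ∃ δ > 0, ∃ C > 0, ε0 < g0 ∧ g0 + ε0 < 1 ∧
      ∀ b : ℕ → ℝ, b 0 = 1 → (∀ k, |b k| ≤ 1) →
      |∑' k, b k * w k| ≤ δ → ∀ x y, |x - g0| ≤ ε0 → |y - g0| ≤ ε0 → ∀ r ≤ δ,
      |∑' k, b k * x ^ e k| ≤ r → |∑' k, b k * y ^ e k| ≤ r → |x - y| ≤ C * r := by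
  set ρ : ℝ := (1 + g0) / 2 with hρd
  have hρ0 : 0 < ρ := by positivity
  have hρ1 : ρ < 1 := by linarith
  have hgρ : g0 < ρ := by linarith
  have hρn : ‖ρ‖ < 1 := by rw [Real.norm_eq_abs, abs_of_pos hρ0]; exact hρ1
  have hS0 : Summable fun i : ℕ => ρ ^ i := summable_geometric_of_lt_one hρ0.le hρ1
  have hS1 : Summable fun i : ℕ => (i : ℝ) * ρ ^ i := by
    simpa using summable_pow_mul_geometric_of_norm_lt_one 1 hρn
  have hS2 : Summable fun i : ℕ => (i : ℝ) ^ 2 * ρ ^ i :=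
    summable_pow_mul_geometric_of_norm_lt_one 2 hρn
  set K : ℕ → ℝ := fun i => |α| * (i * ρ ^ i / ρ) + |β| * ((i : ℝ) ^ 2 * ρ ^ i / ρ ^ 2) with hK
  have hKs : Summable K := by
    apply Summable.add
    · exact (hS1.div_const ρ).mul_left _
    · exact (hS2.div_const _).mul_left _
  have hKe : Summable fun k => K (e k) := hKs.comp_injective he.injective
  have hKn : ∀ i, 0 ≤ K i := fun i => by positivity
  set M : ℝ := ∑' k, K (e k) with hM
  have hM0 : 0 ≤ M := tsum_nonneg fun k => hKn _
  set L : ℕ → ℝ := fun k => c * w k + α * g0 ^ e k + β * (e k * g0 ^ (e k - 1)) with hL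
  have hL0 : L 0 = c * w 0 + α := by simp [hL, he0]
  -- generic summability
  have hpow : ∀ x : ℝ, |x| ≤ ρ → Summable fun k => |x ^ e k| := by
    intro x hx
    have : Summable fun i : ℕ => |x ^ i| := by
      simp_rw [abs_pow]
      exact summable_geometric_of_lt_one (abs_nonneg _) (lt_of_le_of_lt hx hρ1)
    exact this.comp_injective he.injective
  have hbs : ∀ (b u : ℕ → ℝ), (∀ k, |b k| ≤ 1) → (Summable fun k => |u k|) →
      Summable fun k => b k * u k := by
    intro b u hb hu
    refine Summable.of_norm_bounded hu fun k => ?_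
    rw [Real.norm_eq_abs, abs_mul]
    exact mul_le_of_le_one_left (abs_nonneg _) (hb k)
  have hLs : Summable fun k => |L k| := by
    have h1 : Summable fun k => |c| * |w k| := hw.mul_left _
    have h2 : Summable fun k => |α| * |g0 ^ e k| :=
      (hpow g0 (by rw [abs_of_pos hg0]; exact hgρ.le)).mul_left _
    have h3 : Summable fun k => |β| * ((e k : ℝ) * ρ ^ e k / ρ) :=
      ((hS1.div_const ρ).comp_injective he.injective).mul_left _
    refine Summable.of_nonneg_of_le (fun _ => abs_nonneg _) (fun k => ?_) ((h1.add h2).add h3)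
    refine le_trans (abs_add_three _ _ _) ?_
    have : |(e k : ℝ) * g0 ^ (e k - 1)| ≤ (e k : ℝ) * ρ ^ e k / ρ := by
      rw [abs_of_nonneg (by positivity)]
      rcases Nat.eq_zero_or_pos (e k) with h0 | h0
      · simp [h0]
      · obtain ⟨n, hn⟩ : ∃ n, e k = n + 1 := ⟨e k - 1, by omega⟩
        rw [hn, Nat.add_sub_cancel, pow_succ, mul_div_assoc, mul_div_assoc, div_self hρ0.ne', mul_one]
        gcongr
    rw [abs_mul c, abs_mul α, abs_mul β]
    gcongr
  set c0 : ℝ := L 0 - ∑' k, |L (k + 1)| with hc0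
  have hc0p : 0 < c0 := by
    rw [hc0, hL0]; linarith
  set ε0 : ℝ := min (min (g0 / 2) ((1 - g0) / 2 / 2)) (c0 / 2 / (M + 1)) with hε
  have hε0 : 0 < ε0 := by
    apply lt_min (lt_min _ _) <;> [skip; skip; skip] <;> first | positivity | linarith
  have hεa : ε0 ≤ g0 / 2 := le_trans (min_le_left _ _) (min_le_left _ _)
  have hεb : ε0 ≤ (1 - g0) / 2 / 2 := le_trans (min_le_left _ _) (min_le_right _ _)
  have hεM : ε0 * M ≤ c0 / 2 := by
    have : ε0 ≤ c0 / 2 / (M + 1) := min_le_right _ _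
    calc ε0 * M ≤ ε0 * (M + 1) := by nlinarith
      _ ≤ c0 / 2 / (M + 1) * (M + 1) := by gcongr
      _ = c0 / 2 := by field_simp
  set δ : ℝ := c0 / 8 / (|c| + |α| + 1) with hδ
  have hδ0 : 0 < δ := by positivity
  refine ⟨ε0, hε0, δ, hδ0, 8 * (|β| + 1) / c0, by positivity, by linarith, by linarith, ?_⟩
  intro b hb0 hb1 hbw x y hx hy r hr hfx hfy
  have hr0 : 0 ≤ r := le_trans (abs_nonneg _) hfx
  by_cases hxy : x = y
  · subst hxy; simp; positivity
  have hxy' : 0 < |x - y| := abs_pos.2 (sub_ne_zero.2 hxy)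
  have hxρ : |x| ≤ ρ := by
    rw [abs_le] at hx ⊢; constructor <;> linarith [hx.1, hx.2]
  have hyρ : |y| ≤ ρ := by
    rw [abs_le] at hy ⊢; constructor <;> linarith [hy.1, hy.2]
  have hgρ' : |g0| ≤ ρ := by rw [abs_of_pos hg0]; exact hgρ.le
  set D : ℕ → ℝ := fun i => ∑ j ∈ Finset.range i, x ^ j * y ^ (i - 1 - j) with hD
  have hDmul : ∀ i, D i = (x ^ i - y ^ i) / (x - y) := by
    intro i
    rw [eq_div_iff (sub_ne_zero.2 hxy)]
    exact (Commute.all x y).geom_sum₂_mul i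
  set L' : ℕ → ℝ := fun k => c * w k + α * x ^ e k + β * D (e k) with hL'
  have hdiff : ∀ k, |L' k - L k| ≤ ε0 * K (e k) := by
    intro k
    have : L' k - L k = α * (x ^ e k - g0 ^ e k) + β * (D (e k) - e k * g0 ^ (e k - 1)) := by
      simp only [hL', hL]; ring
    rw [this]
    have h1 := pow_sub_bound hρ0 hxρ hgρ' hx (e k)
    have h2 := geom_sub_bound hρ0 hxρ hyρ hgρ' hx hy (e k)
    calc _ ≤ _ := abs_add_le _ _
      _ ≤ |α| * (ε0 * (e k * ρ ^ e k / ρ)) + |β| * (ε0 * ((e k : ℝ) ^ 2 * ρ ^ e k / ρ ^ 2)) := by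
        rw [abs_mul, abs_mul]; gcongr
      _ = _ := by simp only [hK]; ring
  have hds : Summable fun k => |L' k - L k| :=
    Summable.of_nonneg_of_le (fun _ => abs_nonneg _) hdiff (hKe.mul_left _)
  have hsum1 : ∑' k, b k * L' k = ∑' k, b k * L k + ∑' k, b k * (L' k - L k) := by
    rw [← (hbs b L hb1 hLs).tsum_add (hbs b _ hb1 hds)]
    congr 1; ext k; ring
  have hsum2 : ∑' k, b k * L k ≥ c0 := by
    rw [(hbs b L hb1 hLs).tsum_eq_zero_add, hb0, one_mul]
    have : -(∑' k, |L (k + 1)|) ≤ ∑' k, b (k + 1) * L (k + 1) := by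
      rw [← tsum_neg]
      refine Summable.tsum_le_tsum (fun k => ?_) ?_ ?_
      · have : |b (k + 1) * L (k + 1)| ≤ |L (k + 1)| := by
          rw [abs_mul]; exact mul_le_of_le_one_left (abs_nonneg _) (hb1 _)
        linarith [neg_abs_le (b (k + 1) * L (k + 1))]
      · exact ((summable_nat_add_iff 1).2 hLs).neg
      · exact (summable_nat_add_iff 1).2 (hbs b L hb1 hLs)
    linarith
  have hsum3 : ∑' k, b k * (L' k - L k) ≥ -(c0 / 2) := by
    have : -(∑' k, ε0 * K (e k)) ≤ ∑' k, b k * (L' k - L k) := by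
      rw [← tsum_neg]
      refine Summable.tsum_le_tsum (fun k => ?_) (hKe.mul_left _).neg (hbs b _ hb1 hds)
      have : |b k * (L' k - L k)| ≤ ε0 * K (e k) := by
        rw [abs_mul]
        exact le_trans (mul_le_of_le_one_left (abs_nonneg _) (hb1 _)) (hdiff k)
      linarith [neg_abs_le (b k * (L' k - L k))]
    rw [tsum_mul_left] at this
    linarith
  have hsx := hbs b (fun k => x ^ e k) hb1 (hpow x hxρ)
  have hsy := hbs b (fun k => y ^ e k) hb1 (hpow y hyρ)
  have hsw := hbs b w hb1 hw
  have hsum4 : ∑' k, b k * L' k = c * ∑' k, b k * w k + α * ∑' k, b k * x ^ e k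
      + β * ((∑' k, b k * x ^ e k - ∑' k, b k * y ^ e k) / (x - y)) := by
    rw [← hsx.tsum_sub hsy, ← tsum_div_const, ← tsum_mul_left, ← tsum_mul_left, ← tsum_mul_left,
      ← (hsw.mul_left c).tsum_add (hsx.mul_left α),
      ← ((hsw.mul_left c).add (hsx.mul_left α)).tsum_add (((hsx.sub hsy).div_const _).mul_left β)]
    congr 1; ext k
    simp only [hL', hDmul]; ring
  have hbig : c0 / 2 ≤ |c| * δ + |α| * δ + |β| * ((r + r) / |x - y|) := by
    have : c0 / 2 ≤ ∑' k, b k * L' k := by linarith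
    rw [hsum4] at this
    refine le_trans this (le_trans (le_abs_self _) (le_trans (abs_add_three _ _ _) ?_))
    rw [abs_mul c, abs_mul α, abs_mul β, abs_div]
    have : |∑' k, b k * x ^ e k - ∑' k, b k * y ^ e k| ≤ r + r :=
      le_trans (abs_sub _ _) (add_le_add hfx hfy)
    have h2 := le_trans hfx hr
    gcongr
  have hcδ : |c| * δ + |α| * δ ≤ c0 / 8 := by
    have : (|c| + |α| + 1) * δ = c0 / 8 := by rw [hδ]; field_simp
    linarith [hδ0, add_mul (|c| + |α|) 1 δ, add_mul |c| |α| δ]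
  have h5 : c0 / 4 ≤ (|β| + 1) * ((r + r) / |x - y|) := by
    have : 0 ≤ (r + r) / |x - y| := by positivity
    nlinarith
  rw [← mul_div_assoc, le_div_iff₀ hxy'] at h5
  rw [div_mul_eq_mul_div, le_div_iff₀ hc0p]
  nlinarith

end SAB

namespace SAB

lemma hasSum_congr' {f h : ℕ → ℝ} {a : ℝ} (hfh : ∀ j, f j = h j) (hh : HasSum h a) : HasSum f a := by
  have : f = h := funext hfh
  rw [this]; exact hh

lemma hasSum_lin {y : ℝ} (h0 : 0 ≤ y) (h1 : y < 1) (A B : ℝ) :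
    HasSum (fun j : ℕ => (A + B * j) * y ^ j) (A / (1 - y) + B * (y / (1 - y) ^ 2)) := by
  have hn : ‖y‖ < 1 := by rwa [Real.norm_eq_abs, abs_of_nonneg h0]
  have a := (hasSum_geometric_of_lt_one h0 h1).mul_left A
  have b := (hasSum_coe_mul_geometric_of_norm_lt_one hn).mul_left B
  have := a.add b
  rw [div_eq_mul_inv]
  refine hasSum_congr' (fun j => ?_) this
  ring

lemma condA1 (g : ℝ) (h0 : 0 < g) (h1 : g ≤ 0.64) (w : ℕ → ℝ) :
    ∑' k, |0 * w (k + 1) + 1 * g ^ (id (k + 1)) + (-(g / 4)) * ((id (k + 1) : ℕ) * g ^ (id (k + 1) - 1))|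
      < 0 * w 0 + 1 := by
  have hterm : ∀ k : ℕ, |0 * w (k + 1) + 1 * g ^ (id (k + 1)) +
      (-(g / 4)) * ((id (k + 1) : ℕ) * g ^ (id (k + 1) - 1))| = g ^ (k + 1) * |1 - ((k : ℝ) + 1) / 4| := by
    intro k
    nth_rewrite 1 [← abs_of_pos (pow_pos h0 (k + 1))]
    rw [← abs_mul]
    congr 1
    simp only [id, Nat.add_sub_cancel]; push_cast; ring
  simp_rw [hterm]
  have htail : HasSum (fun j : ℕ => g ^ (j + 3 + 1) * |1 - (((j + 3 : ℕ) : ℝ) + 1) / 4|)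
      (g ^ 4 * (0 / (1 - g) + 1 / 4 * (g / (1 - g) ^ 2))) := by
    refine hasSum_congr' (fun j => ?_) ((hasSum_lin h0.le (by linarith) 0 (1 / 4)).mul_left (g ^ 4))
    have : 1 - (((j + 3 : ℕ) : ℝ) + 1) / 4 = -(j / 4) := by push_cast; ring
    rw [this, abs_neg, abs_of_nonneg (by positivity)]; ring
  have hs : HasSum (fun k : ℕ => g ^ (k + 1) * |1 - ((k : ℝ) + 1) / 4|) _ :=
    (hasSum_nat_add_iff (f := fun k : ℕ => g ^ (k + 1) * |1 - ((k : ℝ) + 1) / 4|) 3).1 htail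
  rw [hs.tsum_eq]
  simp only [Finset.sum_range_succ, Finset.sum_range_zero]
  have e1 : |1 - (((0 : ℕ) : ℝ) + 1) / 4| = 3 / 4 := by norm_num [abs_of_pos]
  have e2 : |1 - (((1 : ℕ) : ℝ) + 1) / 4| = 1 / 2 := by norm_num [abs_of_pos]
  have e3 : |1 - (((2 : ℕ) : ℝ) + 1) / 4| = 1 / 4 := by norm_num [abs_of_pos]
  rw [e1, e2, e3]
  have b1 : g ^ 4 * (0 / (1 - g) + 1 / 4 * (g / (1 - g) ^ 2)) ≤
      0.64 ^ 4 * (0 + 1 / 4 * (0.64 / (1 - 0.64) ^ 2)) := by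
    rw [zero_div]; gcongr <;> linarith
  have b2 : g ^ (0 + 1) * (3 / 4) ≤ 0.64 ^ (0 + 1) * (3 / 4) := by gcongr
  have b3 : g ^ (1 + 1) * (1 / 2) ≤ 0.64 ^ (1 + 1) * (1 / 2) := by gcongr
  have b4 : g ^ (2 + 1) * (1 / 4) ≤ 0.64 ^ (2 + 1) * (1 / 4) := by gcongr
  norm_num at b1 b2 b3 b4 ⊢
  linarith

/-- Thinned exponents -/
def EE (i k : ℕ) : ℕ := if i = 0 then k + k / 2 else k + (k + 1) / 2

lemma condA2 (i : ℕ) (g : ℝ) (h0 : 0 < g) (h1 : g ≤ 0.708) (w : ℕ → ℝ) :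
    ∑' k, |0 * w (k + 1) + 1 * g ^ (EE i (k + 1)) + (-(g / 4)) * ((EE i (k + 1) : ℕ) * g ^ (EE i (k + 1) - 1))|
      < 0 * w 0 + 1 := by
  have hpos : ∀ k, 0 < EE i (k + 1) := by
    intro k; unfold EE; split_ifs <;> omega
  have hterm : ∀ k : ℕ, |0 * w (k + 1) + 1 * g ^ (EE i (k + 1)) +
      (-(g / 4)) * ((EE i (k + 1) : ℕ) * g ^ (EE i (k + 1) - 1))| =
      g ^ (EE i (k + 1)) * |1 - ((EE i (k + 1) : ℕ) : ℝ) / 4| := by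
    intro k
    nth_rewrite 2 [← abs_of_pos (pow_pos h0 (EE i (k + 1)))]
    rw [← abs_mul]
    congr 1
    obtain ⟨n, hn⟩ : ∃ n, EE i (k + 1) = n + 1 := ⟨EE i (k + 1) - 1, by have := hpos k; omega⟩
    rw [hn]
    simp only [Nat.add_sub_cancel]; push_cast; ring
  simp_rw [hterm]
  have hy1 : g ^ 3 ≤ 0.355 := by
    calc g ^ 3 ≤ 0.708 ^ 3 := by gcongr
      _ ≤ _ := by norm_num
  have hy0 : 0 ≤ g ^ 3 := by positivity
  set y := g ^ 3 with hy
  have hy' : 0 < 1 - y := by linarith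
  by_cases hi : i = 0
  · have hE : ∀ k, EE i k = k + k / 2 := fun k => by simp [EE, hi]
    simp_rw [hE]
    have hodd : HasSum (fun j : ℕ => g ^ (2 * j + 3 + 1 + (2 * j + 3 + 1) / 2) *
        |1 - (((2 * j + 3 + 1 + (2 * j + 3 + 1) / 2 : ℕ) : ℝ)) / 4|)
        (g ^ 6 * ((2 / 4) / (1 - y) + 3 / 4 * (y / (1 - y) ^ 2))) := by
      refine hasSum_congr' (fun j => ?_) ((hasSum_lin hy0 (by linarith) (2 / 4) (3 / 4)).mul_left (g ^ 6))
      have e : 2 * j + 3 + 1 + (2 * j + 3 + 1) / 2 = 3 * j + 6 := by omega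
      rw [e]
      have : 1 - ((3 * j + 6 : ℕ) : ℝ) / 4 = -(2 / 4 + 3 / 4 * j) := by push_cast; ring
      rw [this, abs_neg, abs_of_nonneg (by positivity), hy]; ring
    have heven : HasSum (fun j : ℕ => g ^ (2 * j + 1 + 3 + 1 + (2 * j + 1 + 3 + 1) / 2) *
        |1 - (((2 * j + 1 + 3 + 1 + (2 * j + 1 + 3 + 1) / 2 : ℕ) : ℝ)) / 4|)
        (g ^ 7 * ((3 / 4) / (1 - y) + 3 / 4 * (y / (1 - y) ^ 2))) := by
      refine hasSum_congr' (fun j => ?_) ((hasSum_lin hy0 (by linarith) (3 / 4) (3 / 4)).mul_left (g ^ 7))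
      have e : 2 * j + 1 + 3 + 1 + (2 * j + 1 + 3 + 1) / 2 = 3 * j + 7 := by omega
      rw [e]
      have : 1 - ((3 * j + 7 : ℕ) : ℝ) / 4 = -(3 / 4 + 3 / 4 * j) := by push_cast; ring
      rw [this, abs_neg, abs_of_nonneg (by positivity), hy]; ring
    have htail := HasSum.even_add_odd (f := fun j : ℕ => g ^ (j + 3 + 1 + (j + 3 + 1) / 2) *
        |1 - (((j + 3 + 1 + (j + 3 + 1) / 2 : ℕ) : ℝ)) / 4|) hodd heven
    have hs : HasSum (fun k : ℕ => g ^ (k + 1 + (k + 1) / 2) *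
        |1 - ((k + 1 + (k + 1) / 2 : ℕ) : ℝ) / 4|) _ :=
      (hasSum_nat_add_iff (f := fun k : ℕ => g ^ (k + 1 + (k + 1) / 2) *
        |1 - ((k + 1 + (k + 1) / 2 : ℕ) : ℝ) / 4|) 3).1 htail
    rw [hs.tsum_eq]
    simp only [Finset.sum_range_succ, Finset.sum_range_zero]
    have e1 : |1 - ((0 + 1 + (0 + 1) / 2 : ℕ) : ℝ) / 4| = 3 / 4 := by norm_num [abs_of_pos]
    have e2 : |1 - ((1 + 1 + (1 + 1) / 2 : ℕ) : ℝ) / 4| = 1 / 4 := by norm_num [abs_of_pos]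
    have e3 : |1 - ((2 + 1 + (2 + 1) / 2 : ℕ) : ℝ) / 4| = 0 := by norm_num
    rw [e1, e2, e3]
    norm_num only
    have b1 : g ^ 6 * (1 / 2 / (1 - y) + 3 / 4 * (y / (1 - y) ^ 2)) ≤
      0.708 ^ 6 * (1 / 2 / (1 - 0.355) + 3 / 4 * (0.355 / (1 - 0.355) ^ 2)) := by
      gcongr <;> linarith
    have b2 : g ^ 7 * (3 / 4 / (1 - y) + 3 / 4 * (y / (1 - y) ^ 2)) ≤
      0.708 ^ 7 * (3 / 4 / (1 - 0.355) + 3 / 4 * (0.355 / (1 - 0.355) ^ 2)) := by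
      gcongr <;> linarith
    norm_num at b1 b2 h1 hy1 ⊢
    have : g ^ 3 = y := rfl
    linarith
  · have hE : ∀ k, EE i k = k + (k + 1) / 2 := fun k => by simp [EE, hi]
    simp_rw [hE]
    have hodd : HasSum (fun j : ℕ => g ^ (2 * j + 2 + 1 + (2 * j + 2 + 1 + 1) / 2) *
        |1 - (((2 * j + 2 + 1 + (2 * j + 2 + 1 + 1) / 2 : ℕ) : ℝ)) / 4|)
        (g ^ 5 * ((1 / 4) / (1 - y) + 3 / 4 * (y / (1 - y) ^ 2))) := by
      refine hasSum_congr' (fun j => ?_) ((hasSum_lin hy0 (by linarith) (1 / 4) (3 / 4)).mul_left (g ^ 5))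
      have e : 2 * j + 2 + 1 + (2 * j + 2 + 1 + 1) / 2 = 3 * j + 5 := by omega
      rw [e]
      have : 1 - ((3 * j + 5 : ℕ) : ℝ) / 4 = -(1 / 4 + 3 / 4 * j) := by push_cast; ring
      rw [this, abs_neg, abs_of_nonneg (by positivity), hy]; ring
    have heven : HasSum (fun j : ℕ => g ^ (2 * j + 1 + 2 + 1 + (2 * j + 1 + 2 + 1 + 1) / 2) *
        |1 - (((2 * j + 1 + 2 + 1 + (2 * j + 1 + 2 + 1 + 1) / 2 : ℕ) : ℝ)) / 4|)
        (g ^ 6 * ((2 / 4) / (1 - y) + 3 / 4 * (y / (1 - y) ^ 2))) := by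
      refine hasSum_congr' (fun j => ?_) ((hasSum_lin hy0 (by linarith) (2 / 4) (3 / 4)).mul_left (g ^ 6))
      have e : 2 * j + 1 + 2 + 1 + (2 * j + 1 + 2 + 1 + 1) / 2 = 3 * j + 6 := by omega
      rw [e]
      have : 1 - ((3 * j + 6 : ℕ) : ℝ) / 4 = -(2 / 4 + 3 / 4 * j) := by push_cast; ring
      rw [this, abs_neg, abs_of_nonneg (by positivity), hy]; ring
    have htail := HasSum.even_add_odd (f := fun j : ℕ => g ^ (j + 2 + 1 + (j + 2 + 1 + 1) / 2) *
        |1 - (((j + 2 + 1 + (j + 2 + 1 + 1) / 2 : ℕ) : ℝ)) / 4|) hodd heven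
    have hs : HasSum (fun k : ℕ => g ^ (k + 1 + (k + 1 + 1) / 2) *
        |1 - ((k + 1 + (k + 1 + 1) / 2 : ℕ) : ℝ) / 4|) _ :=
      (hasSum_nat_add_iff (f := fun k : ℕ => g ^ (k + 1 + (k + 1 + 1) / 2) *
        |1 - ((k + 1 + (k + 1 + 1) / 2 : ℕ) : ℝ) / 4|) 2).1 htail
    rw [hs.tsum_eq]
    simp only [Finset.sum_range_succ, Finset.sum_range_zero]
    have e1 : |1 - ((0 + 1 + (0 + 1 + 1) / 2 : ℕ) : ℝ) / 4| = 1 / 2 := by norm_num [abs_of_pos]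
    have e2 : |1 - ((1 + 1 + (1 + 1 + 1) / 2 : ℕ) : ℝ) / 4| = 1 / 4 := by norm_num [abs_of_pos]
    rw [e1, e2]
    norm_num only
    have b1 : g ^ 5 * (1 / 4 / (1 - y) + 3 / 4 * (y / (1 - y) ^ 2)) ≤
      0.708 ^ 5 * (1 / 4 / (1 - 0.355) + 3 / 4 * (0.355 / (1 - 0.355) ^ 2)) := by
      gcongr <;> linarith
    have b2 : g ^ 6 * (1 / 2 / (1 - y) + 3 / 4 * (y / (1 - y) ^ 2)) ≤
      0.708 ^ 6 * (1 / 2 / (1 - 0.355) + 3 / 4 * (0.355 / (1 - 0.355) ^ 2)) := by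
      gcongr <;> linarith
    have b3 : g ^ 2 ≤ 0.708 ^ 2 := by gcongr
    norm_num at b1 b2 b3 hy1 ⊢
    have : g ^ 3 = y := rfl
    linarith

lemma polyN_pos (g : ℝ) (h0 : 0.63 ≤ g) (h1 : g < 0.708) :
    0 < -3/4 + 7/2*g - 17/2*g^2 + 17*g^3 - 61/2*g^4 + 53*g^5 - 88*g^6 + 142*g^7 - 401/2*g^8
      + 225*g^9 - 238*g^10 + 252*g^11 - 190*g^12 + 60*g^13 := by
  obtain ⟨t, ht, rfl⟩ : ∃ t : ℝ, 0 ≤ t ∧ g = (0.63 + 0.708 * t) / (1 + t) := by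
    refine ⟨(g - 0.63) / (0.708 - g), div_nonneg (by linarith) (by linarith), ?_⟩
    have : 0.708 - g ≠ 0 := by linarith
    field_simp
    ring
  have h1t : 0 < 1 + t := by linarith
  have : 0 < (1 + t) ^ 13 * (-3/4 + 7/2*((0.63 + 0.708 * t) / (1 + t)) - 17/2*((0.63 + 0.708 * t) / (1 + t))^2 + 17*((0.63 + 0.708 * t) / (1 + t))^3 - 61/2*((0.63 + 0.708 * t) / (1 + t))^4 + 53*((0.63 + 0.708 * t) / (1 + t))^5 - 88*((0.63 + 0.708 * t) / (1 + t))^6 + 142*((0.63 + 0.708 * t) / (1 + t))^7 - 401/2*((0.63 + 0.708 * t) / (1 + t))^8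
      + 225*((0.63 + 0.708 * t) / (1 + t))^9 - 238*((0.63 + 0.708 * t) / (1 + t))^10 + 252*((0.63 + 0.708 * t) / (1 + t))^11 - 190*((0.63 + 0.708 * t) / (1 + t))^12 + 60*((0.63 + 0.708 * t) / (1 + t))^13) := by
    field_simp
    ring_nf
    positivity
  exact (mul_pos_iff_of_pos_left (by positivity)).1 this

end SAB

namespace SAB

lemma condB_key (g u A B : ℝ) (h0 : 0.63 ≤ g) (h1 : g < 0.708) (hu : u = 1 / (2 * g ^ 2)) (hu1 : 1 < u)
    (hB : B = (u ^ 7 - u ^ 3) / 4) (hA : A = u ^ 3 - 3 * B) :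
    g * (u - A - B) + g ^ 2 * (u ^ 2 - A - 2 * B) - g ^ 4 * (u ^ 4 - A - 4 * B)
      - g ^ 5 * (u ^ 5 - A - 5 * B) - g ^ 6 * (u ^ 6 - A - 6 * B)
      + g ^ 7 * (u ^ 7 / (1 - g * u) - u ^ 7 / (1 - g) - B * (g / (1 - g) ^ 2)) < 1 - A := by
  have hN := polyN_pos g h0 h1
  have g0 : 0 < g := by linarith
  have a1 : 0 < 1 - g := by linarith
  have a2 : 0 < 2 * g - 1 := by linarith
  have e : 1 - g * u = (2 * g - 1) / (2 * g) := by rw [hu]; field_simp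
  have key : 1 - A - (g * (u - A - B) + g ^ 2 * (u ^ 2 - A - 2 * B) - g ^ 4 * (u ^ 4 - A - 4 * B)
      - g ^ 5 * (u ^ 5 - A - 5 * B) - g ^ 6 * (u ^ 6 - A - 6 * B)
      + g ^ 7 * (u ^ 7 / (1 - g * u) - u ^ 7 / (1 - g) - B * (g / (1 - g) ^ 2))) =
      (u - 1) ^ 2 * (-3/4 + 7/2*g - 17/2*g^2 + 17*g^3 - 61/2*g^4 + 53*g^5 - 88*g^6 + 142*g^7 - 401/2*g^8
      + 225*g^9 - 238*g^10 + 252*g^11 - 190*g^12 + 60*g^13) / (32 * g ^ 10 * (1 - g) ^ 2 * (2 * g - 1)) := by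
    rw [e, hA, hB, hu]
    have n1 := a1.ne'
    have n2 := a2.ne'
    field_simp
    ring
  have : 0 < (u - 1) ^ 2 * (-3/4 + 7/2*g - 17/2*g^2 + 17*g^3 - 61/2*g^4 + 53*g^5 - 88*g^6 + 142*g^7 - 401/2*g^8
      + 225*g^9 - 238*g^10 + 252*g^11 - 190*g^12 + 60*g^13) / (32 * g ^ 10 * (1 - g) ^ 2 * (2 * g - 1)) := by
    have : 0 < u - 1 := by linarith
    positivity
  linarith

lemma condB (g l : ℝ) (h0 : 0.63 ≤ g) (hgl : g < l) (hl : g * l < 1 / 2) :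
    ∃ α β : ℝ, ∑' k, |1 * l ^ (k + 1) + α * g ^ (id (k + 1)) + β * ((id (k + 1) : ℕ) * g ^ (id (k + 1) - 1))|
      < 1 * l ^ 0 + α := by
  have g0 : 0 < g := by linarith
  obtain ⟨u, hu⟩ : ∃ u, u = l / g := ⟨_, rfl⟩
  have hlu : l = g * u := by rw [hu]; field_simp
  have hu1 : 1 < u := by rw [hu, one_lt_div g0]; exact hgl
  obtain ⟨B, hB⟩ : ∃ B, B = (u ^ 7 - u ^ 3) / 4 := ⟨_, rfl⟩
  obtain ⟨A, hA⟩ : ∃ A, A = u ^ 3 - 3 * B := ⟨_, rfl⟩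
  refine ⟨-A, -(B * g), ?_⟩
  obtain ⟨G, hG⟩ : ∃ G, G = Real.sqrt (1 / (2 * u)) := ⟨_, rfl⟩
  have hu0 : 0 < u := by linarith
  have hG2 : G ^ 2 = 1 / (2 * u) := by rw [hG, Real.sq_sqrt]; positivity
  have hGnn : 0 ≤ G := by rw [hG]; exact Real.sqrt_nonneg _
  have hgG : g ≤ G := by
    rw [hG]; apply Real.le_sqrt_of_sq_le
    rw [le_div_iff₀ (by positivity)]
    rw [hlu] at hl; nlinarith
  have hG63 : 0.63 ≤ G := h0.trans hgG
  have hG0 : 0 < G := by linarith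
  have hG708 : G < 0.708 := by
    have : G ^ 2 < 1 / 2 := by
      rw [hG2]; rw [div_lt_div_iff₀ (by positivity) (by norm_num)]; linarith
    nlinarith
  have huG : u = 1 / (2 * G ^ 2) := by rw [hG2]; field_simp
  have hGu : G * u < 1 := by
    rw [huG]; rw [mul_one_div, div_lt_one (by positivity)]; nlinarith
  have key := condB_key G u A B hG63 hG708 huG hu1 hB hA
  obtain ⟨d, hd⟩ : ∃ d, d = u - 1 := ⟨_, rfl⟩
  have hd0 : 0 < d := by linarith
  have hud : u = 1 + d := by linarith
  -- signs
  have W1 : 0 ≤ u - A - B := by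
    rw [hA, hB, hud]; ring_nf; positivity
  have W2 : 0 ≤ u ^ 2 - A - 2 * B := by
    rw [hA, hB, hud]; ring_nf; positivity
  have W4 : 0 ≤ -(u ^ 4 - A - 4 * B) := by
    rw [hA, hB, hud]; ring_nf; positivity
  have W5 : 0 ≤ -(u ^ 5 - A - 5 * B) := by
    rw [hA, hB, hud]; ring_nf; positivity
  have W6 : 0 ≤ -(u ^ 6 - A - 6 * B) := by
    rw [hA, hB, hud]; ring_nf; positivity
  have W7 : ∀ j : ℕ, 0 ≤ u ^ (j + 7) - A - B * ((j : ℝ) + 7) := by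
    intro j
    have hb : 1 + (j : ℝ) * d ≤ u ^ j := by
      rw [hud]; exact one_add_mul_le_pow (by linarith) j
    have h7 : A + 7 * B = u ^ 7 := by rw [hA, hB]; ring
    have hBd : B ≤ u ^ 7 * d := by
      have : 0 ≤ u ^ 7 * d - B := by
        rw [hB, hud]; ring_nf; positivity
      linarith
    have h1 : u ^ 7 * (1 + j * d) ≤ u ^ 7 * u ^ j := by gcongr
    have h2 : (j : ℝ) * B ≤ j * (u ^ 7 * d) := by gcongr
    rw [pow_add]; nlinarith
  set F : ℕ → ℝ := fun k => G ^ (k + 1) * |u ^ (k + 1) - A - B * ((k : ℝ) + 1)| with hF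
  have htail : HasSum (fun j : ℕ => F (j + 6)) (G ^ 7 * (u ^ 7 / (1 - G * u) - u ^ 7 / (1 - G) - B * (G / (1 - G) ^ 2))) := by
    have s1 := (hasSum_geometric_of_lt_one (by positivity) hGu).mul_left (u ^ 7)
    have s2 := hasSum_lin hG0.le (by linarith) (u ^ 7) B
    have s3 := (s1.sub s2).mul_left (G ^ 7)
    have h7 : A = u ^ 7 - 7 * B := by rw [hA, hB]; ring
    have : G ^ 7 * (u ^ 7 / (1 - G * u) - u ^ 7 / (1 - G) - B * (G / (1 - G) ^ 2)) =
       G ^ 7 * (u ^ 7 * (1 - G * u)⁻¹ - (u ^ 7 / (1 - G) + B * (G / (1 - G) ^ 2))) := by ring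
    rw [this]
    refine hasSum_congr' (fun j => ?_) s3
    have e : u ^ (j + 6 + 1) - A - B * (((j + 6 : ℕ) : ℝ) + 1) = u ^ (j + 7) - A - B * ((j : ℝ) + 7) := by
      push_cast; ring
    simp only [hF]
    rw [e, abs_of_nonneg (W7 j), h7, mul_pow]; ring
  have hs : HasSum F _ := (hasSum_nat_add_iff (f := F) 6).1 htail
  have hterm : ∀ k : ℕ, |1 * l ^ (k + 1) + (-A) * g ^ (id (k + 1)) +
      (-(B * g)) * ((id (k + 1) : ℕ) * g ^ (id (k + 1) - 1))| ≤ F k := by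
    intro k
    have : 1 * l ^ (k + 1) + (-A) * g ^ (id (k + 1)) +
      (-(B * g)) * ((id (k + 1) : ℕ) * g ^ (id (k + 1) - 1)) = g ^ (k + 1) * (u ^ (k + 1) - A - B * ((k : ℝ) + 1)) := by
      rw [hlu, mul_pow]; simp only [id, Nat.add_sub_cancel]; push_cast; ring
    rw [this, abs_mul, abs_of_pos (pow_pos g0 _)]
    simp only [hF]; gcongr
  have hle := (Summable.of_nonneg_of_le (fun k => abs_nonneg _) hterm hs.summable).tsum_le_tsum hterm hs.summable
  refine hle.trans_lt ?_
  rw [hs.tsum_eq]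
  simp only [Finset.sum_range_succ, Finset.sum_range_zero, hF]
  have f0 : |u ^ (0 + 1) - A - B * (((0 : ℕ) : ℝ) + 1)| = u - A - B := by
    rw [← abs_of_nonneg W1]; congr 1; push_cast; ring
  have f1 : |u ^ (1 + 1) - A - B * (((1 : ℕ) : ℝ) + 1)| = u ^ 2 - A - 2 * B := by
    rw [← abs_of_nonneg W2]; congr 1; push_cast; ring
  have f2 : |u ^ (2 + 1) - A - B * (((2 : ℕ) : ℝ) + 1)| = 0 := by
    rw [abs_eq_zero, hA]; push_cast; ring
  have f3 : |u ^ (3 + 1) - A - B * (((3 : ℕ) : ℝ) + 1)| = -(u ^ 4 - A - 4 * B) := by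
    rw [← abs_of_nonneg W4, abs_neg]; congr 1; push_cast; ring
  have f4 : |u ^ (4 + 1) - A - B * (((4 : ℕ) : ℝ) + 1)| = -(u ^ 5 - A - 5 * B) := by
    rw [← abs_of_nonneg W5, abs_neg]; congr 1; push_cast; ring
  have f5 : |u ^ (5 + 1) - A - B * (((5 : ℕ) : ℝ) + 1)| = -(u ^ 6 - A - 6 * B) := by
    rw [← abs_of_nonneg W6, abs_neg]; congr 1; push_cast; ring
  rw [f0, f1, f2, f3, f4, f5]
  norm_num only
  linarith [key]

end SAB

namespace SAB

/-- fair coin -/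
def coin : Measure Bool := (2⁻¹ : ℝ≥0∞) • Measure.count

instance : IsProbabilityMeasure coin := ⟨by
  simp only [coin, Measure.smul_apply, smul_eq_mul, Measure.count_univ]
  rw [ENat.card_eq_coe_fintype_card]
  simp
  exact ENNReal.inv_mul_cancel (by norm_num) (by norm_num)⟩

lemma coin_singleton (b : Bool) : coin {b} = 2⁻¹ := by
  simp [coin]

abbrev Om := ℕ → Bool

/-- coin tossing measure -/
def m : Measure Om := Measure.infinitePi (fun _ => coin)

instance : IsProbabilityMeasure m := by unfold m; infer_instance

/-- pairs -/
abbrev m2 : Measure (Om × Om) := m.prod m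

instance : IsProbabilityMeasure m2 := by unfold m2; infer_instance

lemma measurable_extend (u : ℕ → ℕ) (hu : Function.Injective u) :
    Measurable (fun p : Om × Om => (Function.extend u p.1 p.2 : Om)) := by
  rw [measurable_pi_iff]
  intro i
  by_cases h : ∃ k, u k = i
  · obtain ⟨k, rfl⟩ := h
    simp only [hu.extend_apply]
    exact (measurable_pi_apply k).comp measurable_fst
  · simp only [Function.extend_apply' _ _ _ h]
    exact (measurable_pi_apply i).comp measurable_snd

lemma mp_extend (u : ℕ → ℕ) (hu : Function.Injective u) :
    MeasurePreserving (fun p : Om × Om => (Function.extend u p.1 p.2 : Om)) m2 m := by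
  classical
  refine ⟨measurable_extend u hu, ?_⟩
  apply Measure.eq_infinitePi
  intro s t ht
  rw [Measure.map_apply (measurable_extend u hu) (MeasurableSet.pi s.countable_toSet fun i _ => ht i)]
  have : (fun p : Om × Om => (Function.extend u p.1 p.2 : Om)) ⁻¹' (Set.pi s t) =
      (Set.pi (s.preimage u hu.injOn : Finset ℕ) (fun k => t (u k))) ×ˢ
      (Set.pi (s.filter (fun i => ¬ i ∈ Set.range u) : Finset ℕ) t) := by
    ext ⟨ω, η⟩
    simp only [mem_preimage, Set.mem_pi, Finset.mem_coe, mem_prod, Finset.mem_preimage, Finset.mem_filter]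
    constructor
    · intro h
      refine ⟨fun k hk => ?_, fun i hi => ?_⟩
      · simpa [hu.extend_apply] using h _ hk
      · have := h i hi.1
        rwa [Function.extend_apply' _ _ _ (by simpa using hi.2)] at this
    · rintro ⟨h1, h2⟩ i hi
      by_cases h : ∃ k, u k = i
      · obtain ⟨k, rfl⟩ := h
        simpa [hu.extend_apply] using h1 k hi
      · rw [Function.extend_apply' _ _ _ h]
        exact h2 i ⟨hi, by simpa using h⟩
  rw [this, Measure.prod_prod]
  unfold m
  rw [Measure.infinitePi_pi _ (fun i _ => ht _), Measure.infinitePi_pi _ (fun i _ => ht _)]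
  rw [Finset.prod_preimage' u s hu.injOn (fun i => coin (t i))]
  exact Finset.prod_filter_mul_prod_filter_not s (fun i => i ∈ Set.range u) _

lemma mp_rearr' {α : Type*} [MeasurableSpace α] (μ : Measure α) [SFinite μ] : MeasurePreserving
    (fun p : (α × α) × (α × α) => (((p.1.1, p.2.1), (p.1.2, p.2.2)) : (α × α) × (α × α)))
    ((μ.prod μ).prod (μ.prod μ)) ((μ.prod μ).prod (μ.prod μ)) := by
  have h1 := measurePreserving_prodAssoc μ μ (μ.prod μ)
  have h2 : MeasurePreserving (fun p : α × (α × α) => (p.2.1, (p.1, p.2.2))) (μ.prod (μ.prod μ))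
      (μ.prod (μ.prod μ)) := by
    have a := (measurePreserving_prodAssoc μ μ μ).symm
    have b := (Measure.measurePreserving_swap (μ := μ) (ν := μ)).prod (MeasurePreserving.id μ)
    exact (measurePreserving_prodAssoc μ μ μ).comp (b.comp a)
  have h3 := (MeasurePreserving.id μ).prod h2
  exact (h1.symm).comp (h3.comp h1)

lemma mp_rearr : MeasurePreserving
    (fun p : (Om × Om) × (Om × Om) => (((p.1.1, p.2.1), (p.1.2, p.2.2)) : (Om × Om) × (Om × Om)))
    (m2.prod m2) (m2.prod m2) := mp_rearr' m

lemma mp_extend2 (u : ℕ → ℕ) (hu : Function.Injective u) :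
    MeasurePreserving (fun p : (Om × Om) × (Om × Om) =>
      ((Function.extend u p.1.1 p.2.1 : Om), (Function.extend u p.1.2 p.2.2 : Om))) (m2.prod m2) m2 :=
  ((mp_extend u hu).prod (mp_extend u hu)).comp mp_rearr

lemma m_agree (n : ℕ) (η : Om) : m {ζ | ∀ i < n, η i = ζ i} = 2⁻¹ ^ n := by
  have : {ζ : Om | ∀ i < n, η i = ζ i} = Set.pi (Finset.range n : Finset ℕ) (fun i => {η i}) := by
    ext ζ; simp [eq_comm]
  rw [this, m, Measure.infinitePi_pi _ (fun i _ => measurableSet_singleton _)]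
  simp [coin_singleton]

lemma measurableSet_agree (n : ℕ) : MeasurableSet {p : Om × Om | ∀ i < n, p.1 i = p.2 i} := by
  have : {p : Om × Om | ∀ i < n, p.1 i = p.2 i} = ⋂ i, ⋂ (_ : i < n), {p : Om × Om | p.1 i = p.2 i} := by
    ext; simp
  rw [this]
  refine MeasurableSet.iInter fun i => MeasurableSet.iInter fun _ => ?_
  exact measurableSet_eq_fun ((measurable_pi_apply i).comp measurable_fst) ((measurable_pi_apply i).comp measurable_snd)

lemma m2_agree (n : ℕ) : m2 {p | ∀ i < n, p.1 i = p.2 i} = 2⁻¹ ^ n := by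
  rw [Measure.prod_apply (measurableSet_agree n)]
  have : ∀ η : Om, m (Prod.mk η ⁻¹' {p : Om × Om | ∀ i < n, p.1 i = p.2 i}) = 2⁻¹ ^ n := fun η => m_agree n η
  rw [lintegral_congr this]; simp

/-- shift -/
def sh (n : ℕ) (ω : Om) : Om := fun k => ω (n + k)

lemma measurable_sh (n : ℕ) : Measurable (sh n) := by
  rw [measurable_pi_iff]; intro i; exact measurable_pi_apply _

lemma m2_agree_shift (n : ℕ) (F : Set (Om × Om)) (hF : MeasurableSet F) :
    m2 {p | (∀ i < n, p.1 i = p.2 i) ∧ (sh n p.1, sh n p.2) ∈ F} = 2⁻¹ ^ n * m2 F := by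
  have hu : Function.Injective (fun k => n + k) := fun a b h => by simpa using h
  have hS : MeasurableSet {p : Om × Om | (∀ i < n, p.1 i = p.2 i) ∧ (sh n p.1, sh n p.2) ∈ F} := by
    refine (measurableSet_agree n).inter ?_
    exact (((measurable_sh n).comp measurable_fst).prodMk ((measurable_sh n).comp measurable_snd)) hF
  rw [← (mp_extend2 _ hu).measure_preimage hS.nullMeasurableSet, mul_comm, ← m2_agree n, ← Measure.prod_prod]
  congr 1
  ext ⟨⟨a, b⟩, ⟨c, d⟩⟩
  have e1 : ∀ x y : Om, sh n (Function.extend (fun k => n + k) x y) = x := by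
    intro x y; funext k; simp only [sh]; exact hu.extend_apply x y k
  have e2 : ∀ x y : Om, ∀ i < n, Function.extend (fun k => n + k) x y i = y i := by
    intro x y i hi; apply Function.extend_apply'; rintro ⟨k, hk⟩; omega
  simp only [mem_preimage, mem_ofPred_eq, mem_prod, e1]
  constructor
  · rintro ⟨h1, h2⟩; exact ⟨h2, fun i hi => by rw [← e2 a c i hi, ← e2 b d i hi]; exact h1 i hi⟩
  · rintro ⟨h1, h2⟩; exact ⟨fun i hi => by rw [e2 a c i hi, e2 b d i hi]; exact h2 i hi, h1⟩

/-- sign -/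
def sg (b : Bool) : ℝ := if b then 1 else -1

lemma abs_sg (b : Bool) : |sg b| = 1 := by cases b <;> simp [sg]

/-- clamp -/
def cl (x : ℝ) : ℝ := if |x| < 1 then x else 0

lemma cl_of_lt {x : ℝ} (h : |x| < 1) : cl x = x := by simp [cl, h]

lemma abs_cl_lt (x : ℝ) : |cl x| < 1 := by unfold cl; split_ifs with h <;> simp [h]

lemma measurable_cl : Measurable cl :=
  Measurable.ite (measurableSet_lt (by fun_prop) measurable_const) measurable_id measurable_const

/-- random sums -/
def Y (t : ℕ → ℕ) (x : ℝ) (ω : Om) : ℝ := ∑' k, sg (ω k) * cl x ^ t k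

lemma summable_pow {t : ℕ → ℕ} (ht : ∀ k, k ≤ t k) {x : ℝ} (hx : |x| < 1) {b : ℕ → ℝ} {M : ℝ}
    (hb : ∀ k, |b k| ≤ M) :
    Summable (fun k => b k * x ^ t k) := by
  refine Summable.of_norm_bounded ((summable_geometric_of_lt_one (abs_nonneg x) hx).mul_left M) fun k => ?_
  have hM : 0 ≤ M := (abs_nonneg _).trans (hb 0)
  rw [Real.norm_eq_abs, abs_mul, abs_pow]
  exact mul_le_mul (hb k) (pow_le_pow_of_le_one (abs_nonneg _) hx.le (ht k)) (by positivity) hM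

lemma summable_Y {t : ℕ → ℕ} (ht : ∀ k, k ≤ t k) (x : ℝ) (ω : Om) :
    Summable (fun k => sg (ω k) * cl x ^ t k) :=
  summable_pow ht (abs_cl_lt x) (fun k => (abs_sg (ω k)).le)

lemma measurable_Y {t : ℕ → ℕ} (ht : ∀ k, k ≤ t k) : Measurable (fun p : ℝ × Om => Y t p.1 p.2) := by
  have hsg : Measurable sg := measurable_from_top
  refine measurable_of_tendsto_metrizable (f := fun n (p : ℝ × Om) => ∑ k ∈ Finset.range n, sg (p.2 k) * cl p.1 ^ t k) ?_ ?_
  · intro n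
    refine Finset.measurable_sum _ fun k _ => Measurable.mul ?_ ?_
    · exact hsg.comp ((measurable_pi_apply k).comp measurable_snd)
    · exact (measurable_cl.comp measurable_fst).pow_const _
  · rw [tendsto_pi_nhds]
    intro p
    exact (summable_Y ht p.1 p.2).hasSum.tendsto_sum_nat

lemma measurable_Y' {t : ℕ → ℕ} (ht : ∀ k, k ≤ t k) (x : ℝ) : Measurable (Y t x) :=
  (measurable_Y ht).comp (measurable_const.prodMk measurable_id)

/-- collision inequality -/
lemma coll (K L : Om → ℤ) (hK : Measurable K) (hL : Measurable L) :
    2 * m2 {p | K p.1 = L p.2} ≤ m2 {p | K p.1 = K p.2} + m2 {p | L p.1 = L p.2} := by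
  have key : ∀ K L : Om → ℤ, Measurable K → Measurable L →
      m2 {p | K p.1 = L p.2} = ∑' k : ℤ, m (K ⁻¹' {k}) * m (L ⁻¹' {k}) := by
    intro K L hK hL
    have : {p : Om × Om | K p.1 = L p.2} = ⋃ k : ℤ, (K ⁻¹' {k}) ×ˢ (L ⁻¹' {k}) := by
      ext p; simp
      exact eq_comm
    rw [this, measure_iUnion]
    · simp_rw [Measure.prod_prod]
    · intro i j hij
      rw [Function.onFun, Set.disjoint_left]
      rintro p ⟨h1, _⟩ ⟨h2, _⟩
      simp only [mem_preimage, mem_singleton_iff] at h1 h2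
      exact hij (h1.symm.trans h2)
    · intro k
      exact (hK (measurableSet_singleton k)).prod (hL (measurableSet_singleton k))
  rw [key K L hK hL, key K K hK hK, key L L hL hL, ← ENNReal.tsum_mul_left, ← ENNReal.tsum_add]
  refine ENNReal.tsum_le_tsum fun k => ?_
  generalize m (K ⁻¹' {k}) = a
  generalize m (L ⁻¹' {k}) = b
  have h : ∀ a b : ℝ≥0∞, a ≤ b → 2 * (a * b) ≤ a * a + b * b := by
    intro a b hab
    obtain ⟨c, rfl⟩ := exists_add_of_le hab
    calc 2 * (a * (a + c)) ≤ 2 * (a * (a + c)) + c * c := le_self_add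
      _ = _ := by ring
  rcases le_total a b with hab | hab
  · exact h a b hab
  · have := h b a hab
    rwa [mul_comm b a, add_comm] at this

lemma conc (f : Om → ℝ) (hf : Measurable f) (c b : ℝ) (hb : 0 < b) :
    m2 {p | |f p.1 - f p.2 + c| ≤ b} ≤ 3 * m2 {p | |f p.1 - f p.2| ≤ b} := by
  set D := m2 {p | |f p.1 - f p.2| ≤ b} with hD
  have hfl : ∀ h : Om → ℝ, Measurable h → Measurable (fun ω => ⌊h ω⌋) := fun h hh => Int.measurable_floor.comp hh
  have hone : ∀ c : ℝ, ∀ j : ℤ, m2 {p | ⌊(f p.1 + c) / b⌋ + j = ⌊(f p.2 + c) / b⌋ + j} ≤ D := by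
    intro c j
    refine measure_mono fun p hp => ?_
    simp only [mem_ofPred_eq, add_left_inj] at hp ⊢
    have h := Int.abs_sub_lt_one_of_floor_eq_floor hp
    rw [← sub_div, abs_div, abs_of_pos hb, div_lt_one hb] at h
    have : f p.1 + c - (f p.2 + c) = f p.1 - f p.2 := by ring
    rw [this] at h; exact h.le
  have hj : ∀ j : ℤ, m2 {p | ⌊(f p.1 + c) / b⌋ + j = ⌊(f p.2 + 0) / b⌋ + 0} ≤ D := by
    intro j
    have h := coll (fun ω => ⌊(f ω + c) / b⌋ + j) (fun ω => ⌊(f ω + 0) / b⌋ + 0)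
      ((hfl _ (by fun_prop)).add_const j) ((hfl _ (by fun_prop)).add_const 0)
    have h2 := h.trans (add_le_add (hone c j) (hone 0 0))
    rw [← two_mul] at h2
    exact (ENNReal.mul_le_mul_iff_right (by norm_num) (by norm_num)).1 h2
  have hsub : {p : Om × Om | |f p.1 - f p.2 + c| ≤ b} ⊆
      {p | ⌊(f p.1 + c) / b⌋ + (-1) = ⌊(f p.2 + 0) / b⌋ + 0} ∪
      {p | ⌊(f p.1 + c) / b⌋ + 0 = ⌊(f p.2 + 0) / b⌋ + 0} ∪
      {p | ⌊(f p.1 + c) / b⌋ + 1 = ⌊(f p.2 + 0) / b⌋ + 0} := by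
    intro p hp
    simp only [mem_ofPred_eq] at hp
    simp only [mem_union, mem_ofPred_eq]
    rw [abs_le] at hp
    have h1 : (f p.1 + c) / b ≤ (f p.2 + 0) / b + 1 := by
      rw [div_add_one hb.ne', div_le_div_iff_of_pos_right hb]; linarith
    have h2 : (f p.2 + 0) / b ≤ (f p.1 + c) / b + 1 := by
      rw [div_add_one hb.ne', div_le_div_iff_of_pos_right hb]; linarith
    have h1' := Int.floor_le_floor h1
    have h2' := Int.floor_le_floor h2
    rw [Int.floor_add_one] at h1' h2'
    omega
  refine (measure_mono hsub).trans ((measure_union_le _ _).trans ?_)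
  refine (add_le_add ((measure_union_le _ _).trans (add_le_add (hj _) (hj _))) (hj _)).trans ?_
  rw [show (3 : ℝ≥0∞) = 1 + 1 + 1 by norm_num]; ring_nf; exact le_rfl

/-- thinning -/
lemma thin (x : ℝ) (u : ℕ → ℕ) (hu : StrictMono u) (b : ℝ) (hb : 0 < b) :
    m2 {p | |Y id x p.1 - Y id x p.2| ≤ b} ≤ 3 * m2 {p | |Y u x p.1 - Y u x p.2| ≤ b} := by
  have hid : ∀ k, k ≤ id k := fun k => Nat.le_refl k
  have hS : MeasurableSet {p : Om × Om | |Y id x p.1 - Y id x p.2| ≤ b} := by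
    refine measurableSet_le ?_ measurable_const
    exact (((measurable_Y' hid x).comp measurable_fst).sub ((measurable_Y' hid x).comp measurable_snd)).abs
  obtain ⟨R, hR⟩ : ∃ R : Om → ℝ, ∀ ω η : Om, Y id x (Function.extend u ω η) = Y u x ω + R η := by
    refine ⟨fun η => ∑' i : {i // i ∉ Set.range u}, sg (η i) * cl x ^ (i : ℕ), fun ω η => ?_⟩
    unfold Y
    have hs := summable_Y hid x (Function.extend u ω η)
    rw [← hs.tsum_subtype_add_tsum_subtype_compl (Set.range u)]
    congr 1
    · rw [tsum_range (fun i => sg (Function.extend u ω η i) * cl x ^ (id i)) hu.injective]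
      simp [hu.injective.extend_apply]
    · refine tsum_congr fun i => ?_
      rw [Function.extend_apply' _ _ _ (fun h => i.2 h)]; rfl
  rw [← (mp_extend2 u hu.injective).measure_preimage hS.nullMeasurableSet]
  rw [Measure.prod_apply_symm ((mp_extend2 u hu.injective).measurable hS)]
  calc _ ≤ ∫⁻ y : Om × Om, 3 * m2 {p | |Y u x p.1 - Y u x p.2| ≤ b} ∂m2 := by
        refine lintegral_mono fun y => ?_
        refine le_trans (le_of_eq ?_) (conc (Y u x) (measurable_Y' (fun k => hu.le_apply) x) (R y.1 - R y.2) b hb)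
        congr 1
        ext p
        simp only [mem_preimage, mem_ofPred_eq, hR]
        rw [show Y u x p.1 + R y.1 - (Y u x p.2 + R y.2) = Y u x p.1 - Y u x p.2 + (R y.1 - R y.2) by ring]
    _ = _ := by simp

end SAB

namespace SAB

/-- transversality conclusion -/
def TV (e : ℕ → ℕ) (w : ℕ → ℝ) (g0 ε0 δ C : ℝ) : Prop :=
  ∀ b : ℕ → ℝ, b 0 = 1 → (∀ k, |b k| ≤ 1) → |∑' k, b k * w k| ≤ δ →
    ∀ x y, |x - g0| ≤ ε0 → |y - g0| ≤ ε0 → ∀ r ≤ δ,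
      |∑' k, b k * x ^ e k| ≤ r → |∑' k, b k * y ^ e k| ≤ r → |x - y| ≤ C * r

lemma TV.mono {e : ℕ → ℕ} {w : ℕ → ℝ} {g0 ε0 δ C ε1 δ1 C1 : ℝ} (h : TV e w g0 ε0 δ C)
    (h1 : ε1 ≤ ε0) (h2 : δ1 ≤ δ) (h3 : C ≤ C1) : TV e w g0 ε1 δ1 C1 := by
  intro b hb0 hb1 hw x y hx hy r hr hbx hby
  have h0 : 0 ≤ r := (abs_nonneg _).trans hbx
  exact (h b hb0 hb1 (hw.trans h2) x y (hx.trans h1) (hy.trans h1) r (hr.trans h2) hbx hby).trans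
    (mul_le_mul_of_nonneg_right h3 h0)

lemma Y_split {t E : ℕ → ℕ} (n : ℕ) (ht : ∀ k, t (n + k) = t n + E k) (htk : ∀ k, k ≤ t k)
    (x : ℝ) (ω τ : Om) (h : ∀ i < n, ω i = τ i) :
    Y t x ω - Y t x τ = cl x ^ t n * (Y E x (sh n ω) - Y E x (sh n τ)) := by
  unfold Y
  rw [← (summable_Y htk x ω).sum_add_tsum_nat_add n, ← (summable_Y htk x τ).sum_add_tsum_nat_add n]
  have : ∑ k ∈ Finset.range n, sg (ω k) * cl x ^ t k = ∑ k ∈ Finset.range n, sg (τ k) * cl x ^ t k := by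
    refine Finset.sum_congr rfl fun k hk => ?_
    rw [h k (Finset.mem_range.1 hk)]
  rw [this, mul_sub, ← tsum_mul_left, ← tsum_mul_left]
  have e : ∀ ω : Om, ∑' k, sg (ω (k + n)) * cl x ^ t (k + n) = ∑' k, cl x ^ t n * (sg (sh n ω k) * cl x ^ E k) := by
    intro ω
    refine tsum_congr fun k => ?_
    rw [add_comm k n, ht, pow_add]; simp only [sh]; ring
  rw [e, e]; ring

/-- coefficients -/
def bb (ω τ : Om) (k : ℕ) : ℝ := sg (ω 0) * ((sg (ω k) - sg (τ k)) / 2)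

lemma bb_zero {ω τ : Om} (h : ω 0 ≠ τ 0) : bb ω τ 0 = 1 := by
  unfold bb
  cases h1 : ω 0 <;> cases h2 : τ 0 <;> simp_all [sg] <;> norm_num

lemma abs_bb (ω τ : Om) (k : ℕ) : |bb ω τ k| ≤ 1 := by
  unfold bb
  rw [abs_mul, abs_sg, one_mul, abs_div, abs_of_pos (by norm_num : (0:ℝ) < 2)]
  have := abs_sub (sg (ω k)) (sg (τ k))
  rw [abs_sg, abs_sg] at this
  linarith

lemma Y_bb {E : ℕ → ℕ} (hE : ∀ k, k ≤ E k) {x : ℝ} (hx : |x| < 1) (ω τ : Om) :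
    |Y E x ω - Y E x τ| = 2 * |∑' k, bb ω τ k * x ^ E k| := by
  unfold Y
  rw [← (summable_Y hE x ω).tsum_sub (summable_Y hE x τ)]
  have : ∑' k, bb ω τ k * x ^ E k = (sg (ω 0) / 2) * ∑' k, (sg (ω k) * cl x ^ E k - sg (τ k) * cl x ^ E k) := by
    rw [← tsum_mul_left]
    refine tsum_congr fun k => ?_
    rw [cl_of_lt hx]; unfold bb; ring
  rw [this, abs_mul, abs_div, abs_sg, abs_of_pos (by norm_num : (0:ℝ) < 2)]; ring

lemma vol_sec {t E : ℕ → ℕ} (n : ℕ) (ht : ∀ k, t (n + k) = t n + E k) (htk : ∀ k, k ≤ t k) (hE : ∀ k, k ≤ E k)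
    {κ l x0 ε δ C : ℝ} (hl0 : 0 < l) (hl1 : l < 1) (hε : 0 < ε) (hxl : 0 < x0 - ε) (hxu : x0 + ε < 1)
    (hal : x0 - ε ≤ l) (hδ : 0 < δ) (hC : 0 < C)
    (hT : TV E (fun k => κ * l ^ E k) x0 ε δ C)
    {σ : ℝ} (hσ0 : 0 ≤ σ) (hσ1 : σ ≤ 1) (r : ℝ) (hr : 0 < r)
    (ω τ : Om) (hag : ∀ i < n, ω i = τ i) (hne : ω n ≠ τ n) :
    volume ({x | |Y t x ω - Y t x τ| ≤ r ∧ |κ * (Y t l ω - Y t l τ)| ≤ r} ∩ Icc (x0 - ε) (x0 + ε)) ≤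
      ENNReal.ofReal ((C * δ + 2 * ε) * (r / (2 * δ) / (x0 - ε) ^ t n) ^ σ) := by
  obtain ⟨a, ha⟩ : ∃ a, a = x0 - ε := ⟨_, rfl⟩
  rw [← ha] at hxl hal ⊢
  have hap : 0 < a ^ t n := by positivity
  obtain ⟨ρ, hρ⟩ : ∃ ρ, ρ = r / 2 / a ^ t n := ⟨_, rfl⟩
  have hρ0 : 0 < ρ := by rw [hρ]; positivity
  have hq : r / (2 * δ) / a ^ t n = ρ / δ := by rw [hρ]; field_simp
  rw [hq]
  by_cases hcase : ρ ≤ δ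
  · have hx : ∀ x ∈ Icc a (x0 + ε), |Y t x ω - Y t x τ| ≤ r → |∑' k, bb (sh n ω) (sh n τ) k * x ^ E k| ≤ ρ := by
      intro x hx h
      have hx0 : 0 < x := hxl.trans_le hx.1
      have hx1 : |x| < 1 := by rw [abs_of_pos hx0]; linarith [hx.2]
      rw [Y_split n ht htk x ω τ hag, cl_of_lt hx1, abs_mul, Y_bb hE hx1, abs_of_pos (by positivity)] at h
      rw [hρ, le_div_iff₀ hap]
      have : a ^ t n ≤ x ^ t n := by gcongr; exact hx.1
      nlinarith [abs_nonneg (∑' k, bb (sh n ω) (sh n τ) k * x ^ E k)]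
    have hl : |κ * (Y t l ω - Y t l τ)| ≤ r → |∑' k, bb (sh n ω) (sh n τ) k * (κ * l ^ E k)| ≤ δ := by
      intro h
      have hl1 : |l| < 1 := by rwa [abs_of_pos hl0]
      rw [abs_mul, Y_split n ht htk l ω τ hag, cl_of_lt hl1, abs_mul, Y_bb hE hl1, abs_of_pos (pow_pos hl0 _)] at h
      have e : ∑' k, bb (sh n ω) (sh n τ) k * (κ * l ^ E k) = κ * ∑' k, bb (sh n ω) (sh n τ) k * l ^ E k := by
        rw [← tsum_mul_left]; exact tsum_congr fun k => by ring
      rw [e, abs_mul]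
      refine le_trans ?_ hcase
      rw [hρ, le_div_iff₀ hap]
      have : a ^ t n ≤ l ^ t n := by gcongr
      have h3 : 0 ≤ |κ| * |∑' k, bb (sh n ω) (sh n τ) k * l ^ E k| := by positivity
      nlinarith
    have hdiam : Metric.ediam ({x | |Y t x ω - Y t x τ| ≤ r ∧ |κ * (Y t l ω - Y t l τ)| ≤ r} ∩ Icc a (x0 + ε)) ≤
        ENNReal.ofReal (C * ρ) := by
      refine Metric.ediam_le fun x hxx y hyy => ?_
      rw [edist_dist, Real.dist_eq]
      apply ENNReal.ofReal_le_ofReal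
      refine hT (bb (sh n ω) (sh n τ)) (bb_zero (by simpa [sh] using hne)) (abs_bb _ _) (hl hxx.1.2) x y ?_ ?_ ρ hcase
        (hx x hxx.2 hxx.1.1) (hx y hyy.2 hyy.1.1)
      · rw [abs_le]; constructor <;> linarith [hxx.2.1, hxx.2.2]
      · rw [abs_le]; constructor <;> linarith [hyy.2.1, hyy.2.2]
    refine (Real.volume_le_diam _).trans (hdiam.trans (ENNReal.ofReal_le_ofReal ?_))
    have h1 : ρ / δ ≤ (ρ / δ) ^ σ := by
      have := Real.rpow_le_rpow_of_exponent_ge (div_pos hρ0 hδ) ((div_le_one hδ).2 hcase) hσ1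
      rwa [Real.rpow_one] at this
    calc C * ρ = C * δ * (ρ / δ) := by field_simp
      _ ≤ (C * δ + 2 * ε) * (ρ / δ) ^ σ := by gcongr; linarith
  · push Not at hcase
    refine (measure_mono Set.inter_subset_right).trans ?_
    rw [Real.volume_Icc]
    apply ENNReal.ofReal_le_ofReal
    have h1 : 1 ≤ (ρ / δ) ^ σ := Real.one_le_rpow ((one_le_div hδ).2 hcase.le) hσ0
    have : 0 < C * δ := by positivity
    nlinarith

end SAB

namespace SAB

/-- collision probability -/
def Q (κ : ℝ) (t : ℕ → ℕ) (x l r : ℝ) : ℝ≥0∞ :=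
  m2 {p | |Y t x p.1 - Y t x p.2| ≤ r ∧ |κ * (Y t l p.1 - Y t l p.2)| ≤ r}

lemma measurableSet_Q (κ : ℝ) {t : ℕ → ℕ} (ht : ∀ k, k ≤ t k) (r : ℝ) :
    MeasurableSet {q : (ℝ × ℝ) × (Om × Om) | |Y t q.1.1 q.2.1 - Y t q.1.1 q.2.2| ≤ r ∧
      |κ * (Y t q.1.2 q.2.1 - Y t q.1.2 q.2.2)| ≤ r} := by
  have h := measurable_Y ht
  have h11 : Measurable (fun q : (ℝ × ℝ) × (Om × Om) => Y t q.1.1 q.2.1) :=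
    h.comp (f := fun q : (ℝ × ℝ) × (Om × Om) => (q.1.1, q.2.1)) (by fun_prop)
  have h12 : Measurable (fun q : (ℝ × ℝ) × (Om × Om) => Y t q.1.1 q.2.2) :=
    h.comp (f := fun q : (ℝ × ℝ) × (Om × Om) => (q.1.1, q.2.2)) (by fun_prop)
  have h21 : Measurable (fun q : (ℝ × ℝ) × (Om × Om) => Y t q.1.2 q.2.1) :=
    h.comp (f := fun q : (ℝ × ℝ) × (Om × Om) => (q.1.2, q.2.1)) (by fun_prop)
  have h22 : Measurable (fun q : (ℝ × ℝ) × (Om × Om) => Y t q.1.2 q.2.2) :=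
    h.comp (f := fun q : (ℝ × ℝ) × (Om × Om) => (q.1.2, q.2.2)) (by fun_prop)
  exact (measurableSet_le (h11.sub h12).abs measurable_const).inter
    (measurableSet_le ((h21.sub h22).const_mul κ).abs measurable_const)

lemma measurable_Q (κ : ℝ) {t : ℕ → ℕ} (ht : ∀ k, k ≤ t k) (r : ℝ) :
    Measurable (fun z : ℝ × ℝ => Q κ t z.1 z.2 r) :=
  measurable_measure_prodMk_left (measurableSet_Q κ ht r)

lemma avg {t : ℕ → ℕ} {E : ℕ → ℕ → ℕ} (ht : ∀ n k, t (n + k) = t n + E (n % 2) k) (htk : ∀ k, k ≤ t k)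
    (hE : ∀ i k, k ≤ E i k)
    {κ l x0 ε δ C : ℝ} (hl0 : 0 < l) (hl1 : l < 1) (hε : 0 < ε) (hxl : 0 < x0 - ε) (hxu : x0 + ε < 1)
    (hal : x0 - ε ≤ l) (hδ : 0 < δ) (hC : 0 < C)
    (hT : ∀ i < 2, TV (E i) (fun k => κ * l ^ E i k) x0 ε δ C)
    {σ τ C0 : ℝ} (hσ0 : 0 ≤ σ) (hσ1 : σ ≤ 1) (hC0 : 0 ≤ C0)
    (hP : ∀ i < 2, ∀ b > 0, m2 {p | |κ * (Y (E i) l p.1 - Y (E i) l p.2)| ≤ b} ≤ ENNReal.ofReal (C0 * b ^ τ))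
    (hsum : Summable fun n => (1 / 2 : ℝ) ^ n * (((x0 - ε) ^ σ * l ^ τ)⁻¹) ^ t n) :
    ∃ M : ℝ, ∀ r > 0, ∫⁻ x in Icc (x0 - ε) (x0 + ε), Q κ t x l r ≤ ENNReal.ofReal (M * r ^ (τ + σ)) := by
  obtain ⟨a, ha⟩ : ∃ a, a = x0 - ε := ⟨_, rfl⟩
  set K : ℝ := C * δ + 2 * ε with hK
  have hK0 : 0 < K := by positivity
  set s : ℕ → ℝ := fun n => (1 / 2 : ℝ) ^ n * (((x0 - ε) ^ σ * l ^ τ)⁻¹) ^ t n with hs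
  have hs0 : ∀ n, 0 ≤ s n := fun n => by
    have : 0 < (x0 - ε) ^ σ := Real.rpow_pos_of_pos hxl _
    have : 0 < l ^ τ := Real.rpow_pos_of_pos hl0 _
    simp only [hs]; positivity
  refine ⟨K * C0 * ((2 * δ) ^ σ)⁻¹ * ∑' n, s n, fun r hr => ?_⟩
  set F : ℕ → Set (Om × Om) := fun n => {p | |κ * (Y (E (n % 2)) l p.1 - Y (E (n % 2)) l p.2)| ≤ r / l ^ t n} with hF
  have hFm : ∀ n, MeasurableSet (F n) := fun n => by
    have h := measurable_Y' (hE (n % 2)) l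
    exact measurableSet_le (((h.comp measurable_fst).sub (h.comp measurable_snd)).const_mul κ).abs measurable_const
  set G : ℕ → Set (Om × Om) := fun n => {p | (∀ i < n, p.1 i = p.2 i) ∧ (sh n p.1, sh n p.2) ∈ F n} with hG
  have hGm : ∀ n, MeasurableSet (G n) := fun n => by
    refine (measurableSet_agree n).inter ?_
    exact (((measurable_sh n).comp measurable_fst).prodMk ((measurable_sh n).comp measurable_snd)) (hFm n)
  set c : ℕ → ℝ≥0∞ := fun n => ENNReal.ofReal (K * (r / (2 * δ) / (x0 - ε) ^ t n) ^ σ) with hc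
  -- Fubini
  set S : Set (ℝ × (Om × Om)) := {q | |Y t q.1 q.2.1 - Y t q.1 q.2.2| ≤ r ∧
      |κ * (Y t l q.2.1 - Y t l q.2.2)| ≤ r} with hS
  have hSm : MeasurableSet S := by
    have := measurableSet_Q κ htk r
    exact (Measurable.prodMk (measurable_fst.prodMk measurable_const) measurable_snd :
      Measurable (fun q : ℝ × (Om × Om) => ((q.1, l), q.2))) this
  have hfub : ∫⁻ x in Icc (x0 - ε) (x0 + ε), Q κ t x l r =
      ∫⁻ p, volume ({x | |Y t x p.1 - Y t x p.2| ≤ r ∧ |κ * (Y t l p.1 - Y t l p.2)| ≤ r} ∩ Icc (x0 - ε) (x0 + ε)) ∂m2 := by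
    have h1 := Measure.prod_apply (μ := volume.restrict (Icc (x0 - ε) (x0 + ε))) (ν := m2) hSm
    have h2 := Measure.prod_apply_symm (μ := volume.restrict (Icc (x0 - ε) (x0 + ε))) (ν := m2) hSm
    rw [h1] at h2
    refine h2.trans (lintegral_congr fun p => ?_)
    rw [Measure.restrict_apply (measurable_prodMk_right hSm)]
    rfl
  rw [hfub]
  have hdiag : m2 {p | p.1 = p.2} = 0 := by
    have h : ∀ n : ℕ, m2 {p | p.1 = p.2} ≤ 2⁻¹ ^ n := fun n => by
      rw [← m2_agree n]; exact measure_mono fun p hp i _ => by rw [show p.1 = p.2 from hp]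
    have := ENNReal.tendsto_pow_atTop_nhds_zero_of_lt_one (r := 2⁻¹) (by simp)
    exact le_antisymm (ge_of_tendsto' this h) (zero_le)
  have hae : ∀ᵐ p ∂m2, volume ({x | |Y t x p.1 - Y t x p.2| ≤ r ∧ |κ * (Y t l p.1 - Y t l p.2)| ≤ r} ∩ Icc (x0 - ε) (x0 + ε))
      ≤ ∑' n, (G n).indicator (fun _ => c n) p := by
    have : ∀ᵐ p ∂m2, p.1 ≠ p.2 := by
      rw [ae_iff]; simpa using hdiag
    filter_upwards [this] with p hp
    classical
    have hex : ∃ n, p.1 n ≠ p.2 n := by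
      by_contra hcon; push Not at hcon; exact hp (funext hcon)
    set n := Nat.find hex with hn
    have hne : p.1 n ≠ p.2 n := Nat.find_spec hex
    have hag : ∀ i < n, p.1 i = p.2 i := fun i hi => by
      have := Nat.find_min hex hi; simpa using this
    by_cases hmem : p ∈ G n
    · refine le_trans ?_ (ENNReal.le_tsum n)
      rw [indicator_of_mem hmem]
      exact vol_sec n (ht n) htk (hE _) hl0 hl1 hε hxl hxu hal hδ hC
        (hT (n % 2) (Nat.mod_lt _ (by norm_num))) hσ0 hσ1 r hr p.1 p.2 hag hne
    · have : {x | |Y t x p.1 - Y t x p.2| ≤ r ∧ |κ * (Y t l p.1 - Y t l p.2)| ≤ r} = ∅ := by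
        ext x
        simp only [mem_ofPred_eq, mem_empty_iff_false, iff_false, not_and]
        intro _ h2
        apply hmem
        refine ⟨hag, ?_⟩
        simp only [hF, mem_ofPred_eq]
        have hl1' : |l| < 1 := by rwa [abs_of_pos hl0]
        rw [Y_split n (ht n) htk l p.1 p.2 hag, cl_of_lt hl1', mul_left_comm, abs_mul, abs_of_pos (pow_pos hl0 _)] at h2
        rw [le_div_iff₀ (pow_pos hl0 _), mul_comm]; exact h2
      rw [this]; simp
  refine (lintegral_mono_ae hae).trans ?_
  rw [lintegral_tsum (fun n => (measurable_const.indicator (hGm n)).aemeasurable)]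
  have hterm : ∀ n, ∫⁻ p, (G n).indicator (fun _ => c n) p ∂m2 ≤
      ENNReal.ofReal (K * C0 * ((2 * δ) ^ σ)⁻¹ * r ^ (τ + σ) * s n) := by
    intro n
    rw [lintegral_indicator_const (hGm n), hG]
    rw [m2_agree_shift n (F n) (hFm n)]
    have hm := hP (n % 2) (Nat.mod_lt _ (by norm_num)) (r / l ^ t n) (by positivity)
    have h2 : (2⁻¹ : ℝ≥0∞) ^ n = ENNReal.ofReal ((1 / 2) ^ n) := by
      rw [ENNReal.ofReal_pow (by norm_num), ENNReal.ofReal_div_of_pos (by norm_num)]; simp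
    calc c n * (2⁻¹ ^ n * m2 (F n)) ≤ c n * (ENNReal.ofReal ((1 / 2) ^ n) * ENNReal.ofReal (C0 * (r / l ^ t n) ^ τ)) := by
          rw [h2]; gcongr
      _ = ENNReal.ofReal (K * C0 * ((2 * δ) ^ σ)⁻¹ * r ^ (τ + σ) * s n) := by
          simp only [hc]
          rw [← ENNReal.ofReal_mul (by positivity), ← ENNReal.ofReal_mul (by positivity)]
          congr 1
          simp only [hs]
          rw [← ha] at hxl ⊢
          rw [Real.div_rpow (by positivity) (by positivity), Real.div_rpow (by positivity) (by positivity),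
            Real.div_rpow (by positivity) (by positivity), ← Real.rpow_pow_comm hxl.le, ← Real.rpow_pow_comm hl0.le,
            Real.rpow_add hr, mul_inv, mul_pow, inv_pow, inv_pow]
          field_simp
  refine (ENNReal.tsum_le_tsum hterm).trans (le_of_eq ?_)
  rw [← ENNReal.ofReal_tsum_of_nonneg]
  · rw [tsum_mul_left]; congr 1; ring
  · intro n; have := hs0 n; positivity
  · exact hsum.mul_left _

lemma ae_of_avg {X : Type*} [MeasurableSpace X] {μ : Measure X} {f : ℕ → X → ℝ≥0∞} (hf : ∀ j, Measurable (f j)) {M s s' : ℝ} (hs : s' < s)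
    (h : ∀ j : ℕ, ∫⁻ x, f j x ∂μ ≤ ENNReal.ofReal (M * ((1 / 2 : ℝ) ^ j) ^ s)) :
    ∀ᵐ x ∂μ, ∃ N : ℕ, ∀ j : ℕ, f j x ≤ N * ENNReal.ofReal (((1 / 2 : ℝ) ^ j) ^ s') := by
  set H : X → ℝ≥0∞ := fun x => ∑' j, ENNReal.ofReal ((((1 / 2 : ℝ) ^ j) ^ s')⁻¹) * f j x with hH
  have hHm : Measurable H := Measurable.tsum fun j => (hf j).const_mul _
  have hpos : ∀ (j : ℕ) (s : ℝ), 0 < ((1 / 2 : ℝ) ^ j) ^ s := fun j s => Real.rpow_pos_of_pos (by positivity) _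
  have hHint : ∫⁻ x, H x ∂μ ≠ ∞ := by
    rw [hH, lintegral_tsum (fun j => ((hf j).const_mul _).aemeasurable)]
    have hle : ∀ j : ℕ, ∫⁻ x, ENNReal.ofReal ((((1 / 2 : ℝ) ^ j) ^ s')⁻¹) * f j x ∂μ ≤
        ENNReal.ofReal (|M| * ((1 / 2 : ℝ) ^ (s - s')) ^ j) := by
      intro j
      rw [lintegral_const_mul _ (hf j)]
      calc _ ≤ ENNReal.ofReal ((((1 / 2 : ℝ) ^ j) ^ s')⁻¹) * ENNReal.ofReal (|M| * ((1 / 2 : ℝ) ^ j) ^ s) := by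
            gcongr
            refine (h j).trans (ENNReal.ofReal_le_ofReal ?_)
            exact mul_le_mul_of_nonneg_right (le_abs_self M) (hpos j s).le
        _ = _ := by
            rw [← ENNReal.ofReal_mul (inv_nonneg.2 (hpos j s').le)]
            congr 1
            rw [Real.rpow_pow_comm (by norm_num), Real.rpow_sub (by positivity)]
            field_simp
    refine ne_top_of_le_ne_top ?_ (ENNReal.tsum_le_tsum hle)
    rw [← ENNReal.ofReal_tsum_of_nonneg (fun j => by positivity)]
    · exact ENNReal.ofReal_ne_top
    · refine (summable_geometric_of_lt_one (by positivity) ?_).mul_left _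
      exact Real.rpow_lt_one (by norm_num) (by norm_num) (by linarith)
  filter_upwards [ae_lt_top hHm hHint] with x hx
  obtain ⟨N, hN⟩ := ENNReal.exists_nat_gt hx.ne
  refine ⟨N, fun j => ?_⟩
  have h1 : ENNReal.ofReal ((((1 / 2 : ℝ) ^ j) ^ s')⁻¹) * f j x ≤ N := (ENNReal.le_tsum j).trans hN.le
  calc f j x = ENNReal.ofReal (((1 / 2 : ℝ) ^ j) ^ s') * (ENNReal.ofReal ((((1 / 2 : ℝ) ^ j) ^ s')⁻¹) * f j x) := by
        rw [← mul_assoc, ← ENNReal.ofReal_mul (hpos j s').le, mul_inv_cancel₀ (hpos j s').ne']; simp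
    _ ≤ ENNReal.ofReal (((1 / 2 : ℝ) ^ j) ^ s') * N := by gcongr
    _ = _ := mul_comm _ _

end SAB

namespace SAB

lemma loc {t : ℕ → ℕ} {E : ℕ → ℕ → ℕ} (ht : ∀ n k, t (n + k) = t n + E (n % 2) k) (htk : ∀ k, k ≤ t k)
    (hEm : ∀ i, StrictMono (E i)) (hE0 : ∀ i, E i 0 = 0)
    {κ l x0 : ℝ} (hx0 : 0 < x0) (hxl : x0 ≤ l) (hl1 : l < 1)
    (hT : ∀ i < 2, ∃ c α β : ℝ, ∑' k, |c * (κ * l ^ E i (k + 1)) + α * x0 ^ E i (k + 1) +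
      β * (E i (k + 1) * x0 ^ (E i (k + 1) - 1))| < c * (κ * l ^ E i 0) + α)
    {σ τ C0 θ : ℝ} (hσ0 : 0 ≤ σ) (hσ1 : σ ≤ 1) (hτ0 : 0 ≤ τ) (hC0 : 0 ≤ C0)
    (hP : ∀ i < 2, ∀ b > 0, m2 {p | |κ * (Y (E i) l p.1 - Y (E i) l p.2)| ≤ b} ≤ ENNReal.ofReal (C0 * b ^ τ))
    (hθ : ∀ n, (t n : ℝ) ≤ θ * n) (hcond : 1 / 2 < (x0 ^ σ * l ^ τ) ^ θ) {s' : ℝ} (hs' : s' < τ + σ) :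
    ∃ ε > 0, ∀ᵐ x ∂volume.restrict (Icc (x0 - ε) (x0 + ε)),
      ∃ N : ℕ, ∀ j : ℕ, Q κ t x l ((1 / 2) ^ j) ≤ N * ENNReal.ofReal (((1 / 2 : ℝ) ^ j) ^ s') := by
  have hl0 : 0 < l := hx0.trans_le hxl
  have hE : ∀ i k, k ≤ E i k := fun i k => (hEm i).le_apply
  have hx1 : x0 < 1 := hxl.trans_lt hl1
  have hTV : ∀ i < 2, ∃ ε0 > 0, ∃ δ > 0, ∃ C > 0, ε0 < x0 ∧ x0 + ε0 < 1 ∧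
      TV (E i) (fun k => κ * l ^ E i k) x0 ε0 δ C := by
    intro i hi
    obtain ⟨c, α, β, h⟩ := hT i hi
    refine transv (E i) (hEm i) (hE0 i) x0 hx0 hx1 c (fun k => κ * l ^ E i k) ?_ α β h
    have hl1' : |l| < 1 := by rwa [abs_of_pos hl0]
    have := summable_pow (hE i) hl1' (b := fun _ => κ) (M := |κ|) (fun _ => le_rfl)
    exact this.abs
  obtain ⟨ε0, hε0, δ0, hδ0, K0, hK0, a0, b0, T0⟩ := hTV 0 (by norm_num)
  obtain ⟨ε1, hε1, δ1, hδ1, K1, hK1, a1, b1, T1⟩ := hTV 1 (by norm_num)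
  have hcont : ∀ᶠ ε in 𝓝[>] (0 : ℝ), 1 / 2 < ((x0 - ε) ^ σ * l ^ τ) ^ θ := by
    have hc : ContinuousAt (fun ε : ℝ => ((x0 - ε) ^ σ * l ^ τ) ^ θ) 0 := by
      have h1 : ContinuousAt (fun ε : ℝ => (x0 - ε) ^ σ) 0 := by
        refine ContinuousAt.rpow_const (by fun_prop) (Or.inl ?_)
        simpa using hx0.ne'
      refine ContinuousAt.rpow_const (h1.mul continuousAt_const) (Or.inl ?_)
      have : 0 < (x0 - 0) ^ σ * l ^ τ := by rw [sub_zero]; positivity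
      exact this.ne'
    have : 1 / 2 < ((x0 - 0) ^ σ * l ^ τ) ^ θ := by rwa [sub_zero]
    exact ((hc.eventually (lt_mem_nhds this))).filter_mono nhdsWithin_le_nhds
  have hsm : ∀ᶠ ε in 𝓝[>] (0 : ℝ), ε < min ε0 ε1 :=
    (gt_mem_nhds (lt_min hε0 hε1)).filter_mono nhdsWithin_le_nhds
  obtain ⟨ε, ⟨hc, hm⟩, hε⟩ := ((hcont.and hsm).and self_mem_nhdsWithin).exists
  have hε : 0 < ε := hε
  have hm0 : ε < ε0 := hm.trans_le (min_le_left _ _)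
  have hm1 : ε < ε1 := hm.trans_le (min_le_right _ _)
  refine ⟨ε, hε, ?_⟩
  have hapos : 0 < x0 - ε := by linarith
  have hsum : Summable fun n => (1 / 2 : ℝ) ^ n * (((x0 - ε) ^ σ * l ^ τ)⁻¹) ^ t n := by
    obtain ⟨q, hq⟩ : ∃ q, q = ((x0 - ε) ^ σ * l ^ τ)⁻¹ := ⟨_, rfl⟩
    have hq1 : 1 ≤ q := by
      rw [hq]; apply (one_le_inv₀ (by positivity)).2
      exact mul_le_one₀ (Real.rpow_le_one hapos.le (by linarith) hσ0) (by positivity) (Real.rpow_le_one hl0.le hl1.le hτ0)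
    have hq0 : 0 < q := by linarith
    have hq2 : q ^ θ < 2 := by
      rw [hq, Real.inv_rpow (by positivity)]
      rw [show (2 : ℝ) = (1 / 2)⁻¹ by norm_num]
      exact inv_strictAnti₀ (by norm_num) hc
    rw [← hq]
    refine Summable.of_nonneg_of_le (fun n => by positivity) (fun n => ?_)
      (summable_geometric_of_lt_one (r := q ^ θ / 2) (by positivity) (by linarith))
    have : q ^ t n ≤ (q ^ θ) ^ n := by
      rw [← Real.rpow_natCast, ← Real.rpow_natCast (q ^ θ), ← Real.rpow_mul hq0.le]
      exact Real.rpow_le_rpow_of_exponent_le hq1 (hθ n)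
    calc (1 / 2 : ℝ) ^ n * q ^ t n ≤ (1 / 2 : ℝ) ^ n * (q ^ θ) ^ n := by gcongr
      _ = _ := by rw [← mul_pow]; congr 1; ring
  have hTT : ∀ i < 2, TV (E i) (fun k => κ * l ^ E i k) x0 ε (min δ0 δ1) (max K0 K1) := by
    intro i hi
    interval_cases i
    · exact T0.mono hm0.le (min_le_left _ _) (le_max_left _ _)
    · exact T1.mono hm1.le (min_le_right _ _) (le_max_right _ _)
  obtain ⟨M, hM⟩ := avg ht htk hE hl0 hl1 hε hapos (by linarith) (by linarith) (lt_min hδ0 hδ1)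
    (lt_max_of_lt_left hK0) hTT hσ0 hσ1 hC0 hP hsum
  have hmeas : ∀ j : ℕ, Measurable (fun x => Q κ t x l ((1 / 2) ^ j)) := fun j =>
    (measurable_Q κ htk ((1 / 2) ^ j)).comp (f := fun x : ℝ => (x, l)) (measurable_id.prodMk measurable_const)
  exact ae_of_avg (f := fun j x => Q κ t x l ((1 / 2) ^ j)) hmeas hs' (fun j => hM _ (by positivity))

lemma locnull {P : ℝ → Prop} {U : Set ℝ}
    (h : ∀ x0 ∈ U, ∃ ε > 0, ∀ᵐ x ∂volume.restrict (Icc (x0 - ε) (x0 + ε)), P x) : ∀ᵐ x : ℝ, x ∈ U → P x := by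
  rw [ae_iff]
  apply measure_null_of_locally_null
  intro x0 hx0
  simp only [mem_ofPred_eq, Classical.not_imp] at hx0
  obtain ⟨ε, hε, hae⟩ := h x0 hx0.1
  rw [ae_restrict_iff' measurableSet_Icc, ae_iff] at hae
  refine ⟨_, inter_mem_nhdsWithin _ (Icc_mem_nhds (show x0 - ε < x0 by linarith) (show x0 < x0 + ε by linarith)), ?_⟩
  refine measure_mono_null (fun x hx => ?_) hae
  simp only [mem_inter_iff, mem_ofPred_eq, Classical.not_imp] at hx ⊢
  exact ⟨hx.2, hx.1.2⟩

/-- correlation dimension at least one -/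
def Good (t : ℕ → ℕ) (x : ℝ) : Prop := ∀ q : ℚ, (q : ℝ) < 1 → ∃ N : ℕ, ∀ j : ℕ,
  m2 {p | |Y t x p.1 - Y t x p.2| ≤ (1 / 2) ^ j} ≤ N * ENNReal.ofReal (((1 / 2 : ℝ) ^ j) ^ (q : ℝ))

lemma good_of_loc {t : ℕ → ℕ} {E : ℕ → ℕ → ℕ} (ht : ∀ n k, t (n + k) = t n + E (n % 2) k) (htk : ∀ k, k ≤ t k)
    (hEm : ∀ i, StrictMono (E i)) (hE0 : ∀ i, E i 0 = 0) {θ : ℝ} (hθ : ∀ n, (t n : ℝ) ≤ θ * n)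
    (U : Set ℝ) (hU : ∀ x ∈ U, 0 < x ∧ x < 1 ∧ 1 / 2 < x ^ θ)
    (hT : ∀ x0 ∈ U, ∀ w : ℕ → ℝ, ∀ i, ∑' k, |0 * w (k + 1) + 1 * x0 ^ (E i (k + 1)) +
      (-(x0 / 4)) * ((E i (k + 1) : ℕ) * x0 ^ (E i (k + 1) - 1))| < 0 * w 0 + 1) :
    ∀ᵐ x : ℝ, x ∈ U → Good t x := by
  have : ∀ q : ℚ, ∀ᵐ x : ℝ, x ∈ U → ((q : ℝ) < 1 → ∃ N : ℕ, ∀ j : ℕ,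
      m2 {p | |Y t x p.1 - Y t x p.2| ≤ (1 / 2) ^ j} ≤ N * ENNReal.ofReal (((1 / 2 : ℝ) ^ j) ^ (q : ℝ))) := by
    intro q
    refine locnull fun x0 hx0 => ?_
    obtain ⟨h0, h1, h2⟩ := hU x0 hx0
    by_cases hq : (q : ℝ) < 1
    · obtain ⟨ε, hε, hae⟩ := loc (κ := 0) (l := x0) (τ := 0) (σ := 1) (C0 := 1) ht htk hEm hE0 h0 le_rfl h1
        (fun i _ => ⟨0, 1, -(x0 / 4), hT x0 hx0 (fun k => 0 * x0 ^ E i k) i⟩) zero_le_one le_rfl le_rfl zero_le_one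
        (fun i _ b hb => by simpa using prob_le_one) hθ (by simpa using h2) (s' := q) (by simpa using hq)
      refine ⟨ε, hε, hae.mono fun x hx _ => ?_⟩
      obtain ⟨N, hN⟩ := hx
      refine ⟨N, fun j => le_trans (le_of_eq ?_) (hN j)⟩
      unfold Q
      congr 1
      ext p
      simp
    · exact ⟨1, one_pos, Eventually.of_forall fun x h => absurd h hq⟩
  filter_upwards [ae_all_iff.2 this] with x hx hxU q hq
  exact hx q hxU hq

lemma good1 : ∀ᵐ x : ℝ, x ∈ Ioc (1 / 2 : ℝ) 0.64 → Good id x := by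
  refine good_of_loc (E := fun _ => id) (θ := 1) (fun n k => rfl) (fun k => le_refl k) (fun _ => strictMono_id) (fun _ => rfl)
    (fun n => by simp) _ (fun x hx => ⟨by linarith [hx.1], by linarith [hx.2], by simpa using hx.1⟩) ?_
  intro x0 hx0 w i
  exact condA1 x0 (by linarith [hx0.1]) hx0.2 w

lemma good2 : ∀ᵐ x : ℝ, x ∈ Icc (0.63 : ℝ) 0.708 → Good (EE 0) x := by
  refine good_of_loc (E := EE) (θ := 3 / 2) (fun n k => ?_) (fun k => ?_) (fun i => ?_) (fun i => ?_)
    (fun n => ?_) _ (fun x hx => ⟨by linarith [hx.1], by linarith [hx.2], ?_⟩) ?_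
  · rcases Nat.mod_two_eq_zero_or_one n with h | h <;> simp [EE, h] <;> omega
  · simp [EE]
  · refine strictMono_nat_of_lt_succ fun n => ?_
    unfold EE; split_ifs <;> omega
  · unfold EE; split_ifs <;> rfl
  · have : 2 * EE 0 n ≤ 3 * n := by simp [EE]; omega
    have : (2 : ℝ) * EE 0 n ≤ 3 * n := by exact_mod_cast this
    linarith
  · have h0 : (0.63 : ℝ) ≤ x := hx.1
    have hx0 : 0 < x := by linarith
    have h3 : (1 / 2 : ℝ) ^ 2 < (x ^ (3 / 2 : ℝ)) ^ 2 := by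
      rw [← Real.rpow_natCast (x ^ (3 / 2 : ℝ)), ← Real.rpow_mul hx0.le]
      norm_num
      calc (1 / 4 : ℝ) < 0.63 ^ 3 := by norm_num
        _ ≤ x ^ 3 := by gcongr
    exact lt_of_pow_lt_pow_left₀ 2 (by positivity) h3
  · intro x0 hx0 w i
    exact condA2 i x0 (by linarith [hx0.1]) hx0.2 w

lemma null_pow {N : Set ℝ} (hN : volume N = 0) (j : ℕ) (hj : 0 < j) :
    volume {x : ℝ | 0 < x ∧ x ^ j ∈ N} = 0 := by
  have h := addHaar_image_eq_zero_of_differentiableOn_of_addHaar_eq_zero volume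
    (f := fun x : ℝ => x ^ ((j : ℝ)⁻¹)) (s := N ∩ Ioi 0) (fun x hx => ?_) (measure_mono_null Set.inter_subset_left hN)
  · refine measure_mono_null (fun x hx => ?_) h
    exact ⟨x ^ j, ⟨hx.2, pow_pos hx.1 j⟩, Real.pow_rpow_inv_natCast hx.1.le hj.ne'⟩
  · exact (Real.differentiableAt_rpow_const_of_ne _ (ne_of_gt hx.2)).differentiableWithinAt

lemma good_pow {t : ℕ → ℕ} (ht : StrictMono t) {x : ℝ} (h0 : 0 < x) (h1 : x < 1) {j : ℕ} (hj : 0 < j)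
    (h : Good t (x ^ j)) : Good id x := by
  intro q hq
  obtain ⟨N, hN⟩ := h q hq
  refine ⟨3 * N, fun i => ?_⟩
  have hu : StrictMono (fun k => j * t k) := fun a b hab => Nat.mul_lt_mul_of_pos_left (ht hab) hj
  refine (thin x _ hu ((1 / 2) ^ i) (by positivity)).trans ?_
  have e : ∀ ω, Y (fun k => j * t k) x ω = Y t (x ^ j) ω := by
    intro ω
    unfold Y
    refine tsum_congr fun k => ?_
    rw [cl_of_lt (by rwa [abs_of_pos h0]), cl_of_lt (by
      rw [abs_of_pos (by positivity)]; exact pow_lt_one₀ h0.le h1 hj.ne'), pow_mul]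
  simp_rw [e]
  push_cast
  rw [mul_assoc]
  gcongr
  exact hN i

lemma good_all : ∀ᵐ x : ℝ, x ∈ Ioo (1 / 2 : ℝ) 1 → Good id x := by
  have h1 := good1
  have h2 := good2
  rw [ae_iff] at h1 h2
  have h1' : ∀ᵐ x : ℝ, ∀ j : ℕ, 0 < j → ¬ (0 < x ∧ x ^ j ∈ {a | ¬(a ∈ Ioc (1 / 2 : ℝ) 0.64 → Good id a)}) := by
    refine ae_all_iff.2 fun j => ?_
    by_cases hj : 0 < j
    · rw [ae_iff]
      refine measure_mono_null (fun x hx => ?_) (null_pow h1 j hj)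
      simp only [mem_ofPred_eq, Classical.not_imp, not_not] at hx ⊢; exact hx.2
    · exact Eventually.of_forall fun x h => absurd h hj
  have h2' : ∀ᵐ x : ℝ, ∀ j : ℕ, 0 < j → ¬ (0 < x ∧ x ^ j ∈ {a | ¬(a ∈ Icc (0.63 : ℝ) 0.708 → Good (EE 0) a)}) := by
    refine ae_all_iff.2 fun j => ?_
    by_cases hj : 0 < j
    · rw [ae_iff]
      refine measure_mono_null (fun x hx => ?_) (null_pow h2 j hj)
      simp only [mem_ofPred_eq, Classical.not_imp, not_not] at hx ⊢; exact hx.2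
    · exact Eventually.of_forall fun x h => absurd h hj
  filter_upwards [h1', h2'] with x a1 a2 hx
  have hx0 : 0 < x := by linarith [hx.1]
  classical
  have hex : ∃ j : ℕ, x ^ (j + 1) ≤ 1 / 2 := by
    obtain ⟨n, hn⟩ := exists_pow_lt_of_lt_one (show (0 : ℝ) < 1 / 2 by norm_num) hx.2
    exact ⟨n, (pow_le_pow_of_le_one hx0.le hx.2.le (Nat.le_succ n)).trans hn.le⟩
  set j := Nat.find hex with hj
  have hj1 : x ^ (j + 1) ≤ 1 / 2 := Nat.find_spec hex
  have hjpos : 0 < j := by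
    rcases Nat.eq_zero_or_pos j with h | h
    · rw [h] at hj1; simp at hj1; linarith [hx.1]
    · exact h
  have hj2 : 1 / 2 < x ^ j := by
    have := Nat.find_min hex (show j - 1 < j by omega)
    rw [show j - 1 + 1 = j by omega] at this
    exact not_le.1 this
  have hj3 : x ^ j ≤ 0.708 := by
    have : (x ^ j) ^ 2 ≤ 1 / 2 := by
      rw [← pow_mul]; exact (pow_le_pow_of_le_one hx0.le hx.2.le (by omega)).trans hj1
    nlinarith
  by_cases hc : x ^ j ≤ 0.64
  · have := a1 j hjpos
    simp only [mem_ofPred_eq, not_and, not_not] at this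
    exact good_pow strictMono_id hx0 hx.2 hjpos (this hx0 ⟨hj2, hc⟩)
  · have := a2 j hjpos
    simp only [mem_ofPred_eq, not_and, not_not] at this
    refine good_pow ?_ hx0 hx.2 hjpos (this hx0 ⟨by linarith [not_le.1 hc], hj3⟩)
    refine strictMono_nat_of_lt_succ fun n => ?_
    unfold EE; split_ifs <;> omega

end SAB

namespace SAB

lemma dim_lower (f : Om → ℝ × ℝ) (hf : Measurable f) {s s' : ℝ} (hs : 0 < s) (hss : s < s') (N : ℕ)
    (h : ∀ j : ℕ, m2 {p | dist (f p.1) (f p.2) ≤ (1 / 2) ^ j} ≤ N * ENNReal.ofReal (((1 / 2 : ℝ) ^ j) ^ s')) :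
    ENNReal.ofReal s ≤ dimH (range f) := by
  have hSm : ∀ j : ℕ, MeasurableSet {p : Om × Om | dist (f p.1) (f p.2) ≤ (1 / 2) ^ j} := fun j =>
    measurableSet_le ((hf.comp measurable_fst).dist (hf.comp measurable_snd)) measurable_const
  set φ : ℕ → Om → ℝ≥0∞ := fun j ω => m {τ | dist (f ω) (f τ) ≤ (1 / 2) ^ j} with hφ
  have hφm : ∀ j, Measurable (φ j) := fun j => measurable_measure_prodMk_left (hSm j)
  have hae : ∀ᵐ ω ∂m, ∃ N : ℕ, ∀ j : ℕ, φ j ω ≤ N * ENNReal.ofReal (((1 / 2 : ℝ) ^ j) ^ s) := by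
    refine ae_of_avg (M := N) hφm hss fun j => ?_
    have := h j
    rw [Measure.prod_apply (hSm j)] at this
    refine le_trans this (le_of_eq ?_)
    rw [ENNReal.ofReal_mul (by positivity)]; simp
  set A : ℕ → Set Om := fun N => {ω | ∀ j : ℕ, φ j ω ≤ N * ENNReal.ofReal (((1 / 2 : ℝ) ^ j) ^ s)} with hA
  obtain ⟨N, hN⟩ : ∃ N, m (A N) ≠ 0 := by
    by_contra hcon
    push Not at hcon
    have h0 : m (⋃ N, A N) = 0 := measure_iUnion_null hcon
    have h1 : ∀ᵐ ω ∂m, ω ∈ ⋃ N, A N := hae.mono fun ω ⟨N, hN⟩ => mem_iUnion.2 ⟨N, hN⟩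
    have h2 : m univ = 0 := by
      rw [measure_eq_zero_iff_ae_notMem] at h0
      have : ∀ᵐ ω ∂m, False := by filter_upwards [h0, h1] with ω a b using a b
      have h5 : m = 0 := by simpa using this
      rw [h5]; simp
    simp at h2
  set K : ℝ := (N + 1) * 2 ^ s with hK
  have hKpos : 0 < K := by positivity
  have key : ∀ U : Set (ℝ × ℝ), Metric.ediam U ≤ 1 →
      ((m.restrict (A N)).map f) U ≤ ENNReal.ofReal K * Metric.ediam U ^ s := by
    intro U hU
    refine (measure_mono subset_closure).trans ?_
    rw [← Metric.ediam_closure] at hU ⊢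
    have hVm : MeasurableSet (closure U) := isClosed_closure.measurableSet
    rw [Measure.map_apply hf hVm, Measure.restrict_apply (hf hVm)]
    rcases Set.eq_empty_or_nonempty (f ⁻¹' closure U ∩ A N) with he | ⟨ω, hω1, hω2⟩
    · rw [he]; simp
    have hfin : Metric.ediam (closure U) ≠ ⊤ := ne_top_of_le_ne_top (by simp) hU
    set D := (Metric.ediam (closure U)).toReal with hD
    have hD0 : 0 ≤ D := ENNReal.toReal_nonneg
    have hDe : Metric.ediam (closure U) = ENNReal.ofReal D := (ENNReal.ofReal_toReal hfin).symm
    have hD1 : D ≤ 1 := by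
      have := ENNReal.toReal_mono (by simp) hU; rw [ENNReal.toReal_one] at this; exact this
    have hb : ∀ j : ℕ, D ≤ (1 / 2) ^ j → m (f ⁻¹' closure U ∩ A N) ≤ ENNReal.ofReal ((N + 1) * ((1 / 2 : ℝ) ^ j) ^ s) := by
      intro j hj
      have h1 : m (f ⁻¹' closure U ∩ A N) ≤ φ j ω := by
        refine measure_mono fun τ hτ => ?_
        have : edist (f ω) (f τ) ≤ ENNReal.ofReal D := by
          rw [← hDe]; exact Metric.edist_le_ediam_of_mem hω1 hτ.1
        rw [edist_dist] at this
        exact ((ENNReal.ofReal_le_ofReal_iff hD0).1 this).trans hj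
      refine h1.trans ((hω2 j).trans ?_)
      rw [ENNReal.ofReal_mul (by positivity)]
      gcongr
      rw [ENNReal.ofReal_add (by positivity) (by norm_num)]
      simp
    rcases hD0.eq_or_lt with h0 | hpos
    · have h2 : ∀ j : ℕ, m (f ⁻¹' closure U ∩ A N) ≤ ENNReal.ofReal ((N + 1) * ((1 / 2 : ℝ) ^ s) ^ j) := by
        intro j; rw [Real.rpow_pow_comm (by norm_num)]; exact hb j (by rw [← h0]; positivity)
      have h3 : Tendsto (fun j : ℕ => ENNReal.ofReal ((N + 1) * ((1 / 2 : ℝ) ^ s) ^ j)) atTop (𝓝 (ENNReal.ofReal ((N + 1) * 0))) := by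
        refine ENNReal.tendsto_ofReal (Tendsto.const_mul _ ?_)
        exact tendsto_pow_atTop_nhds_zero_of_lt_one (by positivity) (Real.rpow_lt_one (by norm_num) (by norm_num) hs)
      have h4 := ge_of_tendsto' h3 h2
      refine h4.trans ?_
      simp
    · obtain ⟨j, hj1, hj2⟩ := exists_nat_pow_near_of_lt_one hpos hD1 (show (0 : ℝ) < 1 / 2 by norm_num) (by norm_num)
      refine (hb j hj2).trans ?_
      rw [hDe, ENNReal.ofReal_rpow_of_pos hpos, ← ENNReal.ofReal_mul hKpos.le]
      apply ENNReal.ofReal_le_ofReal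
      rw [hK, mul_assoc, ← Real.mul_rpow (by norm_num) hD0]
      gcongr
      rw [pow_succ] at hj1
      linarith
  have hle := Measure.le_hausdorffMeasure s ((ENNReal.ofReal K)⁻¹ • ((m.restrict (A N)).map f)) 1 one_pos (by
    intro U hU
    rw [Measure.smul_apply, smul_eq_mul, mul_comm, ← div_eq_mul_inv]
    refine ENNReal.div_le_of_le_mul ?_
    rw [mul_comm]; exact key U hU)
  have hne : μH[s] (range f) ≠ 0 := by
    intro h0
    have h1 := (hle (range f)).trans_eq h0
    rw [Measure.smul_apply, smul_eq_mul] at h1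
    have h2 := (mul_eq_zero.1 (le_antisymm h1 (zero_le))).resolve_left (by simp)
    have h3 := Measure.le_map_apply (μ := m.restrict (A N)) hf.aemeasurable (range f)
    rw [h2] at h3
    have h4 : (m.restrict (A N)) univ = 0 := by
      have e : f ⁻¹' range f = univ := by ext; simp
      rw [e] at h3; exact le_antisymm h3 (zero_le)
    rw [Measure.restrict_apply_univ] at h4
    exact hN h4
  have : ((s.toNNReal : NNReal) : ℝ≥0∞) ≤ dimH (range f) := by
    apply le_dimH_of_hausdorffMeasure_ne_zero
    rwa [Real.coe_toNNReal _ hs.le]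
  exact this

end SAB

namespace SAB

lemma tail_bound {x R : ℝ} (h0 : 0 < x) (h1 : x < 1) (hR : 1 / (1 - x) ≤ R) {b : ℕ → ℝ} (hb : ∀ k, |b k| ≤ 1) (n : ℕ) :
    |∑' k, b k * x ^ k - ∑ k ∈ Finset.range n, b k * x ^ k| ≤ R * x ^ n := by
  have hx : |x| < 1 := by rwa [abs_of_pos h0]
  have hs := summable_pow (t := id) (fun k => le_refl k) hx hb
  simp only [id] at hs
  rw [← hs.sum_add_tsum_nat_add n, add_sub_cancel_left]
  have hg := (hasSum_geometric_of_lt_one h0.le h1).mul_right (x ^ n)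
  have := tsum_of_norm_bounded (f := fun k => b (k + n) * x ^ (k + n)) hg (fun k => by
    rw [Real.norm_eq_abs, abs_mul, abs_of_pos (pow_pos h0 _), ← pow_add]
    exact mul_le_of_le_one_left (by positivity) (hb _))
  refine this.trans ?_
  rw [← one_div]
  gcongr

lemma dim_upper (g l : ℝ) (hg : 1 / 2 < g) (hgl : g < l) (hl : l < 1) :
    dimH (Kpm g l) ≤ ENNReal.ofReal (1 + Real.log (2 * l) / Real.log (1 / g)) := by
  have hg0 : 0 < g := by linarith
  have hl0 : 0 < l := by linarith
  have hg1 : g < 1 := by linarith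
  set s : ℝ := 1 + Real.log (2 * l) / Real.log (1 / g) with hs
  have hlog1 : 0 < Real.log (1 / g) := Real.log_pos (by rw [one_lt_div hg0]; exact hg1)
  have hlog2 : 0 < Real.log (2 * l) := Real.log_pos (by linarith)
  have hs0 : 0 < s := by positivity
  have hkey : 2 * (l / g) * g ^ s = 1 := by
    have h1 : g ^ s = g * (2 * l)⁻¹ := by
      rw [hs, Real.rpow_add hg0, Real.rpow_one]
      congr 1
      rw [Real.rpow_def_of_pos hg0]
      have : Real.log g * (Real.log (2 * l) / Real.log (1 / g)) = Real.log ((2 * l)⁻¹) := by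
        rw [Real.log_inv, one_div, Real.log_inv] at *
        have : Real.log g ≠ 0 := by linarith
        field_simp
      rw [this, Real.exp_log (by positivity)]
    rw [h1]; field_simp
  set R : ℝ := 1 / (1 - l) with hR
  have hR0 : 0 < R := by rw [hR]; apply one_div_pos.2; linarith
  have hRg : 1 / (1 - g) ≤ R := by rw [hR]; apply one_div_le_one_div_of_le <;> linarith
  have hne : μH[s] (Kpm g l) ≠ ⊤ := by
    set M : ℕ → ℕ := fun n => ⌊(l / g) ^ n⌋₊ + 1 with hM
    let t : ∀ n : ℕ, ((Fin n → Bool) × Fin (M n)) → Set (ℝ × ℝ) := fun n i =>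
      Icc (∑ k : Fin n, sg (i.1 k) * g ^ (k : ℕ) - R * g ^ n) (∑ k : Fin n, sg (i.1 k) * g ^ (k : ℕ) + R * g ^ n) ×ˢ
      Icc (∑ k : Fin n, sg (i.1 k) * l ^ (k : ℕ) - R * l ^ n + 2 * R * g ^ n * (i.2 : ℕ))
        (∑ k : Fin n, sg (i.1 k) * l ^ (k : ℕ) - R * l ^ n + 2 * R * g ^ n * ((i.2 : ℕ) + 1))
    have hdiam : ∀ n i, Metric.ediam (t n i) ≤ ENNReal.ofReal (2 * R * g ^ n) := by
      intro n i
      refine Metric.ediam_le fun p hp q hq => ?_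
      rw [edist_dist]
      apply ENNReal.ofReal_le_ofReal
      obtain ⟨⟨p1, p2⟩, ⟨p3, p4⟩⟩ := hp
      obtain ⟨⟨q1, q2⟩, ⟨q3, q4⟩⟩ := hq
      rw [Prod.dist_eq, max_le_iff, Real.dist_eq, Real.dist_eq, abs_le, abs_le]
      refine ⟨⟨?_, ?_⟩, ⟨?_, ?_⟩⟩ <;> linarith
    have hcov : ∀ n, Kpm g l ⊆ ⋃ i, t n i := by
      rintro n p ⟨ε, hε, rfl⟩
      have hb : ∀ k, |ε k| ≤ 1 := fun k => by rcases hε k with h | h <;> rw [h] <;> simp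
      have t1 := tail_bound hg0 hg1 hRg hb n
      have t2 := tail_bound hl0 hl le_rfl hb n
      rw [← hR] at t2
      set X := ∑' k, ε k * g ^ k
      set Z := ∑' k, ε k * l ^ k
      classical
      let a : Fin n → Bool := fun k => decide (ε k = 1)
      have ha : ∀ k : Fin n, sg (a k) = ε k := by
        intro k
        rcases hε k with h | h
        · simp [a, h, sg]
        · simp only [a, h, sg]; norm_num
      have e1 : ∀ x : ℝ, ∑ k : Fin n, sg (a k) * x ^ (k : ℕ) = ∑ k ∈ Finset.range n, ε k * x ^ k := by
        intro x
        rw [← Fin.sum_univ_eq_sum_range (fun k => ε k * x ^ k)]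
        exact Finset.sum_congr rfl fun k _ => by rw [ha]
      rw [abs_le] at t1 t2
      set v : ℝ := (Z - ∑ k ∈ Finset.range n, ε k * l ^ k + R * l ^ n) / (2 * R * g ^ n) with hv
      have hden : 0 < 2 * R * g ^ n := by positivity
      have hv0 : 0 ≤ v := div_nonneg (by linarith) hden.le
      have hv1 : v ≤ (l / g) ^ n := by
        rw [hv, div_le_iff₀ hden, div_pow]
        have : l ^ n / g ^ n * (2 * R * g ^ n) = 2 * R * l ^ n := by field_simp
        rw [this]; linarith
      have hvl : ⌊v⌋₊ < M n := Nat.lt_succ_of_le (Nat.floor_le_floor hv1)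
      refine mem_iUnion.2 ⟨(a, ⟨⌊v⌋₊, hvl⟩), ?_⟩
      have hfl := Nat.floor_le hv0
      have hfu := Nat.lt_floor_add_one v
      have hvm : 2 * R * g ^ n * v = Z - ∑ k ∈ Finset.range n, ε k * l ^ k + R * l ^ n := by
        rw [hv]; field_simp
      have m1 := mul_le_mul_of_nonneg_left hfl hden.le
      have m2 := mul_le_mul_of_nonneg_left hfu.le hden.le
      rw [hvm] at m1 m2
      refine ⟨⟨?_, ?_⟩, ⟨?_, ?_⟩⟩ <;> simp only [e1] <;> linarith
    have hr : Tendsto (fun n : ℕ => ENNReal.ofReal (2 * R * g ^ n)) atTop (𝓝 0) := by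
      have h1 : Tendsto (fun n : ℕ => 2 * R * g ^ n) atTop (𝓝 (2 * R * 0)) :=
        (tendsto_pow_atTop_nhds_zero_of_lt_one hg0.le hg1).const_mul _
      rw [mul_zero] at h1
      simpa using ENNReal.tendsto_ofReal h1
    have hle := Measure.hausdorffMeasure_le_liminf_sum s (Kpm g l) _ hr t
      (Eventually.of_forall fun n i => hdiam n i) (Eventually.of_forall hcov)
    have hsumle : ∀ n, ∑ i, Metric.ediam (t n i) ^ s ≤ ENNReal.ofReal (2 * (2 * R) ^ s) := by
      intro n
      have hden : 0 < 2 * R * g ^ n := by positivity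
      calc ∑ i, Metric.ediam (t n i) ^ s ≤ ∑ i : (Fin n → Bool) × Fin (M n), ENNReal.ofReal ((2 * R * g ^ n) ^ s) := by
            refine Finset.sum_le_sum fun i _ => ?_
            rw [← ENNReal.ofReal_rpow_of_pos hden]
            exact ENNReal.rpow_le_rpow (hdiam n i) hs0.le
        _ = ENNReal.ofReal ((2 ^ n * M n : ℕ) * (2 * R * g ^ n) ^ s) := by
            rw [Finset.sum_const, Finset.card_univ, Fintype.card_prod, Fintype.card_fun, Fintype.card_fin, Fintype.card_bool,
              Fintype.card_fin, nsmul_eq_mul, ENNReal.ofReal_mul (by positivity), ENNReal.ofReal_natCast]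
        _ ≤ _ := by
            apply ENNReal.ofReal_le_ofReal
            have hlg : 1 ≤ (l / g) ^ n := one_le_pow₀ (by rw [one_le_div hg0]; exact hgl.le)
            have hMn : (M n : ℝ) ≤ 2 * (l / g) ^ n := by
              simp only [hM]; push_cast
              linarith [Nat.floor_le (show 0 ≤ (l / g) ^ n by positivity)]
            rw [Real.mul_rpow (by positivity) (by positivity), ← Real.rpow_pow_comm hg0.le]
            push_cast
            calc (2 : ℝ) ^ n * M n * ((2 * R) ^ s * (g ^ s) ^ n) ≤ (2 : ℝ) ^ n * (2 * (l / g) ^ n) * ((2 * R) ^ s * (g ^ s) ^ n) := by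
                  gcongr
              _ = 2 * (2 * R) ^ s * (2 * (l / g) * g ^ s) ^ n := by rw [mul_pow, mul_pow]; ring
              _ = _ := by rw [hkey]; simp
    refine ne_top_of_le_ne_top (ENNReal.ofReal_ne_top (r := 2 * (2 * R) ^ s)) (hle.trans ?_)
    exact (liminf_le_liminf (Eventually.of_forall hsumle)).trans_eq (liminf_const _)
  have : dimH (Kpm g l) ≤ ((s.toNNReal : NNReal) : ℝ≥0∞) := by
    apply dimH_le_of_hausdorffMeasure_ne_top
    rwa [Real.coe_toNNReal _ hs0.le]
  exact this

end SAB

namespace SAB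

lemma good_frost {l : ℝ} (h : Good id l) {q : ℚ} (hq0 : 0 ≤ (q : ℝ)) (hq : (q : ℝ) < 1) :
    ∃ C0 : ℝ, 0 ≤ C0 ∧ ∀ b > 0, m2 {p | |(1 : ℝ) * (Y id l p.1 - Y id l p.2)| ≤ b} ≤
      ENNReal.ofReal (C0 * b ^ (q : ℝ)) := by
  obtain ⟨N, hN⟩ := h q hq
  refine ⟨(N + 1) * 2 ^ (q : ℝ), by positivity, fun b hb => ?_⟩
  have h2 : (1 : ℝ) ≤ 2 ^ (q : ℝ) := Real.one_le_rpow (by norm_num) hq0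
  rcases le_or_gt b 1 with hb1 | hb1
  · obtain ⟨j, hj1, hj2⟩ := exists_nat_pow_near_of_lt_one hb hb1 (show (0 : ℝ) < 1 / 2 by norm_num)
      (by norm_num)
    have hmono : m2 {p | |(1 : ℝ) * (Y id l p.1 - Y id l p.2)| ≤ b} ≤
        m2 {p | |Y id l p.1 - Y id l p.2| ≤ (1 / 2) ^ j} := by
      apply measure_mono
      intro p hp
      simp only [Set.mem_ofPred_eq, one_mul] at hp ⊢
      exact hp.trans hj2
    refine (hmono.trans (hN j)).trans ?_
    rw [← ENNReal.ofReal_natCast, ← ENNReal.ofReal_mul (by positivity)]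
    apply ENNReal.ofReal_le_ofReal
    have h3 : ((1 / 2 : ℝ) ^ j) ^ (q : ℝ) ≤ (2 * b) ^ (q : ℝ) := by
      apply Real.rpow_le_rpow (by positivity) _ hq0
      rw [pow_succ] at hj1
      linarith
    rw [Real.mul_rpow (by norm_num) hb.le] at h3
    have h4 : 0 ≤ (2 : ℝ) ^ (q : ℝ) * b ^ (q : ℝ) := by positivity
    have h5 : (0 : ℝ) ≤ N := by positivity
    calc (N : ℝ) * ((1 / 2 : ℝ) ^ j) ^ (q : ℝ) ≤ N * ((2 : ℝ) ^ (q : ℝ) * b ^ (q : ℝ)) :=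
          mul_le_mul_of_nonneg_left h3 h5
      _ ≤ _ := by nlinarith
  · refine prob_le_one.trans ?_
    rw [← ENNReal.ofReal_one]
    apply ENNReal.ofReal_le_ofReal
    have h3 : (1 : ℝ) ≤ b ^ (q : ℝ) := Real.one_le_rpow hb1.le hq0
    have h5 : (0 : ℝ) ≤ N := by positivity
    have h6 : (1 : ℝ) ≤ (N + 1) * 2 ^ (q : ℝ) := by nlinarith
    nlinarith

/-- conditions -/
def UU (q : ℚ) : Set (ℝ × ℝ) := {p | 1 / 2 < p.1 ∧ p.1 < p.2 ∧ p.2 < 1 ∧ p.1 * p.2 < 1 / 2 ∧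
  (q : ℝ) < 1 + Real.log (2 * p.2) / Real.log (1 / p.1)}

lemma measurableSet_UU (q : ℚ) : MeasurableSet (UU q) := by
  have h5 : MeasurableSet {p : ℝ × ℝ | (q : ℝ) < 1 + Real.log (2 * p.2) / Real.log (1 / p.1)} :=
    measurableSet_lt (by fun_prop) (by fun_prop)
  have h1 : MeasurableSet {p : ℝ × ℝ | 1 / 2 < p.1} := measurableSet_lt (by fun_prop) (by fun_prop)
  have h2 : MeasurableSet {p : ℝ × ℝ | p.1 < p.2} := measurableSet_lt (by fun_prop) (by fun_prop)
  have h3 : MeasurableSet {p : ℝ × ℝ | p.2 < 1} := measurableSet_lt (by fun_prop) (by fun_prop)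
  have h4 : MeasurableSet {p : ℝ × ℝ | p.1 * p.2 < 1 / 2} :=
    measurableSet_lt (by fun_prop) (by fun_prop)
  exact h1.inter (h2.inter (h3.inter (h4.inter h5)))

/-- conclusion -/
def CC (q : ℚ) (p : ℝ × ℝ) : Prop :=
  ∃ N : ℕ, ∀ j : ℕ, Q 1 id p.1 p.2 ((1 / 2) ^ j) ≤ N * ENNReal.ofReal (((1 / 2 : ℝ) ^ j) ^ (q : ℝ))

lemma measurableSet_CC (q : ℚ) : MeasurableSet {p | CC q p} := by
  have : {p | CC q p} = ⋃ N : ℕ, ⋂ j : ℕ, {p : ℝ × ℝ | Q 1 id p.1 p.2 ((1 / 2) ^ j) ≤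
      N * ENNReal.ofReal (((1 / 2 : ℝ) ^ j) ^ (q : ℝ))} := by
    ext p; simp [CC]
  rw [this]
  refine MeasurableSet.iUnion fun N => MeasurableSet.iInter fun j => ?_
  have hQ := measurable_Q 1 (t := id) (fun k => le_rfl) ((1 / 2) ^ j)
  exact measurableSet_le hQ measurable_const

lemma fiber (q : ℚ) {l : ℝ} (hl : Good id l) : ∀ᵐ x : ℝ, (x, l) ∈ UU q → CC q (x, l) := by
  refine locnull (U := {x | (x, l) ∈ UU q}) (P := fun x => CC q (x, l)) ?_
  rintro x ⟨h1, h2, h3, h4, h5⟩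
  simp only at h1 h2 h3 h4 h5
  have hx0 : 0 < x := by linarith
  have hl0 : 0 < l := by linarith
  have hlogx : 0 < Real.log (1 / x) := Real.log_pos (by rw [lt_div_iff₀ hx0]; linarith)
  have hlogl : 0 < Real.log (2 * l) := Real.log_pos (by linarith)
  set σ := Real.log (2 * l) / Real.log (1 / x) with hσ
  have hσ0 : 0 < σ := by positivity
  have hσ1 : σ ≤ 1 := by
    rw [hσ, div_le_one hlogx]
    apply Real.log_le_log (by linarith)
    rw [le_div_iff₀ hx0]; nlinarith
  obtain ⟨τ, hτ1, hτ2⟩ := exists_rat_btwn (show max 0 ((q : ℝ) - σ) < 1 from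
    max_lt one_pos (by linarith))
  have hτ0 : 0 ≤ (τ : ℝ) := (le_max_left _ _).trans hτ1.le
  have hτq : (q : ℝ) - σ < τ := (le_max_right _ _).trans_lt hτ1
  obtain ⟨C0, hC0, hfr⟩ := good_frost hl hτ0 hτ2
  have hxs : x ^ σ = 1 / (2 * l) := by
    rw [Real.rpow_def_of_pos hx0]
    have : Real.log x * σ = Real.log (1 / (2 * l)) := by
      rw [hσ, one_div, Real.log_inv, one_div, Real.log_inv]
      have : Real.log x ≠ 0 := by
        rw [one_div, Real.log_inv] at hlogx; linarith
      field_simp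
    rw [this, Real.exp_log (by positivity)]
  refine loc (t := id) (E := fun _ => id) (κ := 1) (σ := σ) (τ := τ) (θ := 1) (C0 := C0)
    (fun n k => rfl) (fun k => le_rfl) (fun _ => strictMono_id) (fun _ => rfl) hx0 h2.le h3 ?_ hσ0.le hσ1
    hτ0 hC0 (fun i _ b hb => hfr b hb) (fun n => by simp) ?_ (by linarith)
  · intro i _
    rcases le_or_gt x 0.64 with hx | hx
    · refine ⟨0, 1, -(x / 4), ?_⟩
      have := condA1 x hx0 hx (fun k => 1 * l ^ k)
      simpa using this
    · obtain ⟨α, β, h⟩ := condB x l (by linarith) h2 h4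
      refine ⟨1, α, β, ?_⟩
      simpa using h
  · rw [Real.rpow_one, hxs]
    have : l < l ^ (τ : ℝ) := by
      have := Real.rpow_lt_rpow_of_exponent_gt hl0 h3 hτ2
      rwa [Real.rpow_one] at this
    rw [div_mul_eq_mul_div, one_mul, lt_div_iff₀ (by positivity)]
    linarith

lemma all_ae (q : ℚ) : ∀ᵐ p : ℝ × ℝ, p ∈ UU q → CC q p := by
  have hm : MeasurableSet {p : ℝ × ℝ | p ∈ UU q → CC q p} := by
    have : {p : ℝ × ℝ | p ∈ UU q → CC q p} = (UU q)ᶜ ∪ {p | CC q p} := by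
      ext p; simp [imp_iff_not_or]
    rw [this]
    exact (measurableSet_UU q).compl.union (measurableSet_CC q)
  rw [Measure.volume_eq_prod, Measure.ae_prod_iff_ae_ae hm,
    Measure.ae_ae_comm (p := fun x y => (x, y) ∈ UU q → CC q (x, y)) hm]
  filter_upwards [good_all] with l hl
  by_cases h : l ∈ Ioo (1 / 2 : ℝ) 1
  · exact fiber q (hl h)
  · refine Eventually.of_forall fun x hx => absurd ?_ h
    obtain ⟨h1, h2, h3, -⟩ := hx
    simp only at h1 h2 h3
    exact ⟨h1.trans h2, h3⟩

lemma lower {g l : ℝ} (hg : 1 / 2 < g) (hgl : g < l) (hl : l < 1) (hp : g * l < 1 / 2)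
    (h : ∀ q : ℚ, (g, l) ∈ UU q → CC q (g, l)) :
    ENNReal.ofReal (1 + Real.log (2 * l) / Real.log (1 / g)) ≤ dimH (Kpm g l) := by
  set S := 1 + Real.log (2 * l) / Real.log (1 / g) with hS
  set f : Om → ℝ × ℝ := fun ω => (Y id g ω, Y id l ω) with hf
  have hfm : Measurable f := (measurable_Y' (fun k => le_rfl) g).prodMk (measurable_Y' (fun k => le_rfl) l)
  have hsub : range f ⊆ Kpm g l := by
    rintro _ ⟨ω, rfl⟩
    refine ⟨fun n => sg (ω n), fun n => ?_, ?_⟩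
    · show sg (ω n) = 1 ∨ sg (ω n) = -1
      cases h : ω n <;> simp [sg]
    · have h1 : cl g = g := cl_of_lt (by rw [abs_lt]; constructor <;> linarith)
      have h2 : cl l = l := cl_of_lt (by rw [abs_lt]; constructor <;> linarith)
      simp [hf, Y, h1, h2]
  have key : ∀ s : ℝ, 0 < s → s < S → ENNReal.ofReal s ≤ dimH (Kpm g l) := by
    intro s hs0 hs
    obtain ⟨q, hq1, hq2⟩ := exists_rat_btwn hs
    obtain ⟨N, hN⟩ := h q ⟨hg, hgl, hl, hp, hq2⟩
    refine (dim_lower f hfm hs0 hq1 N fun j => ?_).trans (dimH_mono hsub)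
    refine le_trans (measure_mono ?_) (hN j)
    intro p hp
    simpa [hf, Prod.dist_eq, Real.dist_eq] using hp
  by_contra hlt
  push Not at hlt
  have hne : dimH (Kpm g l) ≠ ⊤ := hlt.ne_top
  have h1 : (dimH (Kpm g l)).toReal < S := by
    rwa [ENNReal.lt_ofReal_iff_toReal_lt hne] at hlt
  obtain ⟨s, hs1, hs2⟩ := exists_between h1
  have hs0 : 0 < s := ENNReal.toReal_nonneg.trans_lt hs1
  have := key s hs0 hs2
  rw [ENNReal.ofReal_le_iff_le_toReal hne] at this
  linarith

end SAB

/-- For Lebesgue-almost every pair `(γ,λ)` with `0 < γ < λ < 1`, `γλ < 1/2` and `γ > 1/2`,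
the Hausdorff dimension of `K_{γ,λ}` equals `1 + log(2λ)/log(1/γ)`. -/
theorem hausdorff_dimension_selfaffine_bernoulli :
    ∀ᵐ p : ℝ × ℝ ∂volume,
      (0 < p.1 ∧ p.1 < p.2 ∧ p.2 < 1 ∧ p.1 * p.2 < 1 / 2 ∧ 1 / 2 < p.1) →
        dimH (Kpm p.1 p.2) =
          ENNReal.ofReal (1 + Real.log (2 * p.2) / Real.log (1 / p.1)) := by
  filter_upwards [ae_all_iff.2 SAB.all_ae] with p hp
  rintro ⟨-, h1, h2, h3, h4⟩
  exact le_antisymm (SAB.dim_upper _ _ h4 h1 h2) (SAB.lower h4 h1 h2 h3 hp)
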